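/- arXiv:2109.00655 — 7 statements merged into one kernel-verified Lean document; each statement's English description precedes it below -/
import Mathlib

section
/- Theorem 1 (tetrahedral case). For every tetrahedral disk packing y₁, y₂, y₃, y₄ there exists an orthoplicial sphere packing x such that the set of curvatures of the tetrahedral Apollonian packing Ω(y) is contained in the set of curvatures of the orthoplicial Apollonian packing Ω(x), i.e. {κ(b) : b ∈ Ω(y)} ⊆ {κ'(b) : b ∈ Ω(x)}; moreover Ω(y) is integral if and only if Ω(x) is integral. -/
noncomputable section

/-- Inversive product on ℝ⁴. -/
def Q2 (a b : Fin 4 → ℝ) : ℝ := a 0 * b 0 + a 1 * b 1 + a 2 * b 2 - a 3 * b 3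

/-- Curvature of a disk in inversive coordinates. -/
def curv2 (a : Fin 4 → ℝ) : ℝ := a 3 - a 2

/-- Inversive product on ℝ⁵. -/
def Q3 (a b : Fin 5 → ℝ) : ℝ := a 0 * b 0 + a 1 * b 1 + a 2 * b 2 + a 3 * b 3 - a 4 * b 4

/-- Curvature of a sphere in inversive coordinates. -/
def curv3 (a : Fin 5 → ℝ) : ℝ := a 4 - a 3

/-- A tetrahedral disk packing: four pairwise tangent disks. -/
def IsTetraPacking (y : Fin 4 → (Fin 4 → ℝ)) : Prop :=
  (∀ i, Q2 (y i) (y i) = 1) ∧ ∀ i j, i ≠ j → Q2 (y i) (y j) = -1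

/-- Generators of the tetrahedral Apollonian group: reflections in vectors of norm 1
orthogonal to three of the four disks. -/
def tetraGens (y : Fin 4 → (Fin 4 → ℝ)) : Set ((Fin 4 → ℝ) ≃ₗ[ℝ] (Fin 4 → ℝ)) :=
  {g | ∃ w : Fin 4 → ℝ, Q2 w w = 1 ∧ (∃ i : Fin 4, ∀ j, j ≠ i → Q2 w (y j) = 0) ∧
        ∀ z, g z = z - (2 * Q2 z w) • w}

/-- The tetrahedral Apollonian packing: the orbit of the packing under the Apollonian group. -/
def tetraOmega (y : Fin 4 → (Fin 4 → ℝ)) : Set (Fin 4 → ℝ) :=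
  {b | ∃ g ∈ Subgroup.closure (tetraGens y), ∃ i, b = g (y i)}

/-- An orthoplicial sphere packing, indexed by `{±1,±2,±3,±4}` (here `Fin 4 × Bool`,
with negation flipping the boolean). -/
def IsOrthoPacking (x : Fin 4 × Bool → (Fin 5 → ℝ)) : Prop :=
  (∀ k, Q3 (x k) (x k) = 1) ∧
  (∀ k l, l ≠ k → l ≠ (k.1, !k.2) → Q3 (x k) (x l) = -1) ∧
  (∀ k, Q3 (x k) (x (k.1, !k.2)) = -3)

/-- Generators of the orthoplicial Apollonian group. -/
def orthoGens (x : Fin 4 × Bool → (Fin 5 → ℝ)) : Set ((Fin 5 → ℝ) ≃ₗ[ℝ] (Fin 5 → ℝ)) :=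
  {g | ∃ w : Fin 5 → ℝ, Q3 w w = 1 ∧ (∃ ε : Fin 4 → Bool, ∀ i, Q3 w (x (i, ε i)) = 0) ∧
        ∀ z, g z = z - (2 * Q3 z w) • w}

/-- The orthoplicial Apollonian packing. -/
def orthoOmega (x : Fin 4 × Bool → (Fin 5 → ℝ)) : Set (Fin 5 → ℝ) :=
  {b | ∃ g ∈ Subgroup.closure (orthoGens x), ∃ k, b = g (x k)}

theorem Q2_comm (a b : Fin 4 → ℝ) : Q2 a b = Q2 b a := by
  unfold Q2; ring

theorem Q2_sub_left (a b c : Fin 4 → ℝ) : Q2 (a - b) c = Q2 a c - Q2 b c := by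
  simp only [Q2, Pi.sub_apply]; ring

theorem Q2_sub_right (a b c : Fin 4 → ℝ) : Q2 a (b - c) = Q2 a b - Q2 a c := by
  simp only [Q2, Pi.sub_apply]; ring

theorem Q2_sum_right (a : Fin 4 → ℝ) (f : Fin 4 → Fin 4 → ℝ) :
    Q2 a (∑ i, f i) = ∑ i, Q2 a (f i) := by
  simp only [Q2, Fin.sum_univ_four, Pi.add_apply]; ring

theorem Q3_comm (a b : Fin 5 → ℝ) : Q3 a b = Q3 b a := by
  unfold Q3; ring

theorem Q3_add_left (a b c : Fin 5 → ℝ) : Q3 (a + b) c = Q3 a c + Q3 b c := by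
  simp only [Q3, Pi.add_apply]; ring

theorem Q3_add_right (a b c : Fin 5 → ℝ) : Q3 a (b + c) = Q3 a b + Q3 a c := by
  simp only [Q3, Pi.add_apply]; ring

theorem Q3_sub_left (a b c : Fin 5 → ℝ) : Q3 (a - b) c = Q3 a c - Q3 b c := by
  simp only [Q3, Pi.sub_apply]; ring

theorem Q3_sub_right (a b c : Fin 5 → ℝ) : Q3 a (b - c) = Q3 a b - Q3 a c := by
  simp only [Q3, Pi.sub_apply]; ring

theorem Q3_smul_left (t : ℝ) (a b : Fin 5 → ℝ) : Q3 (t • a) b = t * Q3 a b := by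
  simp only [Q3, Pi.smul_apply, smul_eq_mul]; ring

theorem Q3_smul_right (t : ℝ) (a b : Fin 5 → ℝ) : Q3 a (t • b) = t * Q3 a b := by
  simp only [Q3, Pi.smul_apply, smul_eq_mul]; ring

theorem Q3_sum_right (a : Fin 5 → ℝ) (f : Fin 4 → Fin 5 → ℝ) :
    Q3 a (∑ i, f i) = ∑ i, Q3 a (f i) := by
  simp only [Q3, Fin.sum_univ_four, Pi.add_apply]; ring

/-- Expansion of a vector of ℝ⁵ in an orthogonal basis for the inversive product. -/
theorem eq_sum_of_Q3_orthogonal (b : Fin 5 → Fin 5 → ℝ) (d : Fin 5 → ℝ) (hd : ∀ i, d i ≠ 0)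
    (hb : ∀ i j, Q3 (b i) (b j) = if i = j then d j else 0) (z : Fin 5 → ℝ) :
    z = ∑ j, (Q3 z (b j) / d j) • b j := by
  let N : Matrix (Fin 5) (Fin 5) ℝ :=
    Matrix.of fun k j => (![1, 1, 1, 1, -1] : Fin 5 → ℝ) k * b j k / d j
  have hN (a : Fin 5 → ℝ) (j : Fin 5) : ∑ k, a k * N k j = Q3 a (b j) / d j := by
    simp [N, Fin.sum_univ_five, Q3]
    ring
  have h1 : Matrix.of b * N = 1 := by
    ext i j
    rw [Matrix.mul_apply, Matrix.one_apply]
    simp only [Matrix.of_apply, hN, hb]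
    split_ifs
    · exact div_self (hd j)
    · exact zero_div _
  have h2 : Matrix.vecMul (Matrix.vecMul z N) (Matrix.of b) = z := by
    rw [Matrix.vecMul_vecMul, mul_eq_one_comm.mp h1, Matrix.vecMul_one]
  nth_rewrite 1 [← h2]
  ext k
  simp only [Matrix.vecMul, dotProduct, hN, Matrix.of_apply, Finset.sum_apply, Pi.smul_apply,
    smul_eq_mul]

namespace IsOrthoPacking

variable {x : Fin 4 × Bool → Fin 5 → ℝ}

theorem gram (hx : IsOrthoPacking x) (i j : Fin 4) (a b : Bool) :
    Q3 (x (i, a)) (x (j, b)) = if i = j then (if a = b then 1 else -3) else -1 := by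
  obtain ⟨h1, h2, h3⟩ := hx
  split_ifs with hij hab
  · rw [hij, hab]; exact h1 _
  · obtain rfl : b = !a := by cases a <;> cases b <;> simp_all
    rw [hij]; exact h3 (j, a)
  · apply h2 <;> simp [Ne.symm hij]

/-- Expansion in the orthogonal basis formed by `x₁ + x₋₁` and the differences `xᵢ - x₋ᵢ`. -/
theorem eq_sum (hx : IsOrthoPacking x) (z : Fin 5 → ℝ) :
    z = (Q3 z (x (0, true) + x (0, false)) / -4) • (x (0, true) + x (0, false)) +
      ∑ i, (Q3 z (x (i, true) - x (i, false)) / 8) • (x (i, true) - x (i, false)) := by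
  have h := eq_sum_of_Q3_orthogonal
    (Fin.cons (x (0, true) + x (0, false)) fun i => x (i, true) - x (i, false))
    (Fin.cons (-4) fun _ => 8) ?_ ?_ z
  · simpa [Fin.sum_univ_succ (n := 4)] using h
  · intro i
    cases i using Fin.cases <;> simp
  · intro i j
    cases i using Fin.cases <;> cases j using Fin.cases <;>
      simp only [Fin.cons_zero, Fin.cons_succ, Q3_add_left, Q3_add_right, Q3_sub_left,
        Q3_sub_right, hx.gram, Fin.succ_inj, Fin.succ_ne_zero, (Fin.succ_ne_zero _).symm] <;>
      split_ifs <;> simp_all <;> norm_num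

/-- The sum of two opposite spheres does not depend on the pair. -/
theorem add_opposite (hx : IsOrthoPacking x) (i : Fin 4) :
    x (i, true) + x (i, false) = x (0, true) + x (0, false) := by
  rw [← sub_eq_zero, hx.eq_sum (x (i, true) + x (i, false) - _)]
  have h1 : Q3 (x (i, true) + x (i, false) - (x (0, true) + x (0, false)))
      (x (0, true) + x (0, false)) = 0 := by
    simp only [Q3_add_left, Q3_add_right, Q3_sub_left, hx.gram]
    split_ifs <;> simp_all <;> norm_num
  have h2 (j : Fin 4) : Q3 (x (i, true) + x (i, false) - (x (0, true) + x (0, false)))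
      (x (j, true) - x (j, false)) = 0 := by
    simp only [Q3_add_left, Q3_sub_right, Q3_sub_left, hx.gram]
    split_ifs <;> simp_all <;> norm_num
  simp [h1, h2]

theorem normal_eq (hx : IsOrthoPacking x) {w : Fin 5 → ℝ} {ε : Fin 4 → Bool}
    (hw : ∀ i, Q3 w (x (i, ε i)) = 0) :
    w = (Q3 w (x (0, true) + x (0, false)) / 4) •
      (x (0, true) + x (0, false) - ∑ i, x (i, ε i)) := by
  have key (i : Fin 4) :
      (Q3 w (x (i, true) - x (i, false)) / 8) • (x (i, true) - x (i, false)) =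
        (Q3 w (x (0, true) + x (0, false)) / 8) •
          (x (0, true) + x (0, false) - (2 : ℝ) • x (i, ε i)) := by
    have h := hw i
    rw [← hx.add_opposite i, Q3_add_right, Q3_sub_right]
    cases hε : ε i <;> rw [hε] at h <;> rw [h] <;> module
  nth_rewrite 1 [hx.eq_sum w]
  simp only [key, Fin.sum_univ_four]
  module

theorem apply_mem_closure_range (hx : IsOrthoPacking x) {g : (Fin 5 → ℝ) ≃ₗ[ℝ] (Fin 5 → ℝ)}
    (hg : g ∈ orthoGens x) {z : Fin 5 → ℝ} (hz : z ∈ AddSubgroup.closure (Set.range x)) :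
    g z ∈ AddSubgroup.closure (Set.range x) := by
  obtain ⟨w, hww, ⟨ε, hw⟩, hg⟩ := hg
  have hmem (k) : x k ∈ AddSubgroup.closure (Set.range x) :=
    AddSubgroup.subset_closure ⟨k, rfl⟩
  set v := x (0, true) + x (0, false) with hv
  have hwv : w = (Q3 w v / 4) • (v - ∑ i, x (i, ε i)) := hx.normal_eq hw
  have hq : Q3 w v * Q3 w v = 4 := by
    have h := hww
    nth_rewrite 2 [hwv] at h
    rw [Q3_smul_right, Q3_sub_right, Q3_sum_right] at h
    simp only [hw, Finset.sum_const_zero] at h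
    linarith
  induction hz using AddSubgroup.closure_induction with
  | zero => simp
  | add a b _ _ ha hb => rw [map_add]; exact add_mem ha hb
  | neg a _ ha => rw [map_neg]; exact neg_mem ha
  | mem a ha =>
    obtain ⟨⟨i, s⟩, rfl⟩ := ha
    rw [hg]
    refine sub_mem (hmem _) ?_
    by_cases hs : s = ε i
    · rw [hs, Q3_comm, hw]; simp
    · have h1 : Q3 (x (i, s)) w = Q3 w v := by
        have h := hw i
        rw [Q3_comm, hv, ← hx.add_opposite i, Q3_add_right]
        rw [Bool.eq_not.mpr hs]
        cases hε : ε i <;> rw [hε] at h <;> rw [h] <;> simp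
      have h2 : (2 * Q3 w v) • w = (2 : ℕ) • (v - ∑ i, x (i, ε i)) := by
        nth_rewrite 2 [hwv]
        rw [smul_smul, show 2 * Q3 w v * (Q3 w v / 4) = (2 : ℕ) by push_cast; linarith,
          Nat.cast_smul_eq_nsmul]
      rw [h1, h2]
      exact nsmul_mem (sub_mem (add_mem (hmem _) (hmem _)) (sum_mem fun i _ => hmem _)) 2

theorem inv_mem_orthoGens {g : (Fin 5 → ℝ) ≃ₗ[ℝ] (Fin 5 → ℝ)} (hg : g ∈ orthoGens x) :
    g⁻¹ ∈ orthoGens x := by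
  obtain ⟨w, hww, hw, hg⟩ := hg
  refine ⟨w, hww, hw, fun z => ?_⟩
  change g.symm z = _
  rw [LinearEquiv.symm_apply_eq, hg, Q3_sub_left, Q3_smul_left, hww]
  module

theorem orthoOmega_subset_closure_range (hx : IsOrthoPacking x) :
    orthoOmega x ⊆ AddSubgroup.closure (Set.range x) := by
  rintro _ ⟨g, hg, k, rfl⟩
  suffices ∀ z ∈ AddSubgroup.closure (Set.range x), g z ∈ AddSubgroup.closure (Set.range x) from
    this _ (AddSubgroup.subset_closure ⟨k, rfl⟩)
  induction hg using Subgroup.closure_induction'' with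
  | mem g hg => exact fun z hz => hx.apply_mem_closure_range hg hz
  | inv_mem g hg => exact fun z hz => hx.apply_mem_closure_range (inv_mem_orthoGens hg) hz
  | one => exact fun z hz => hz
  | mul g h _ _ hg hh => exact fun z hz => hg _ (hh z hz)

theorem integral (hx : IsOrthoPacking x) (h : ∀ k, ∃ n : ℤ, curv3 (x k) = n) :
    ∀ b ∈ orthoOmega x, ∃ n : ℤ, curv3 b = n := by
  intro b hb
  have hmem := hx.orthoOmega_subset_closure_range hb
  clear hb
  induction hmem using AddSubgroup.closure_induction with
  | mem a ha => obtain ⟨k, rfl⟩ := ha; exact h k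
  | zero => exact ⟨0, by simp [curv3]⟩
  | add a b _ _ ha hb =>
    obtain ⟨m, hm⟩ := ha
    obtain ⟨n, hn⟩ := hb
    refine ⟨m + n, ?_⟩
    rw [Int.cast_add, ← hm, ← hn]
    simp only [curv3, Pi.add_apply]
    ring
  | neg a _ ha =>
    obtain ⟨m, hm⟩ := ha
    refine ⟨-m, ?_⟩
    rw [Int.cast_neg, ← hm]
    simp only [curv3, Pi.neg_apply]
    ring

end IsOrthoPacking

/-- The point of ℝ⁵ over `a` at height `t` in the third coordinate. -/
def liftAt (t : ℝ) (a : Fin 4 → ℝ) : Fin 5 → ℝ := ![a 0, a 1, t, a 2, a 3]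

theorem Q3_liftAt (s t : ℝ) (a b : Fin 4 → ℝ) :
    Q3 (liftAt s a) (liftAt t b) = Q2 a b + s * t := by
  simp [Q3, Q2, liftAt]; ring

theorem curv3_liftAt (t : ℝ) (a : Fin 4 → ℝ) : curv3 (liftAt t a) = curv2 a := by
  simp [curv3, curv2, liftAt]

/-- The orthoplicial packing whose positive half is a given tetrahedral packing. -/
def orthoOfTetra (y : Fin 4 → Fin 4 → ℝ) : Fin 4 × Bool → Fin 5 → ℝ
  | (i, true) => liftAt 0 (y i)
  | (i, false) => liftAt 2 (∑ j, y j - y i)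

theorem IsTetraPacking.gram {y : Fin 4 → Fin 4 → ℝ} (hy : IsTetraPacking y) (i j : Fin 4) :
    Q2 (y i) (y j) = if i = j then 1 else -1 := by
  split_ifs with h
  · rw [h]; exact hy.1 j
  · exact hy.2 i j h

theorem IsTetraPacking.Q2_sum {y : Fin 4 → Fin 4 → ℝ} (hy : IsTetraPacking y) (i : Fin 4) :
    Q2 (y i) (∑ j, y j) = -2 := by
  rw [Q2_sum_right]
  simp only [hy.gram]
  fin_cases i <;> simp [Fin.sum_univ_four] <;> norm_num

theorem IsTetraPacking.orthoOfTetra_gram {y : Fin 4 → Fin 4 → ℝ} (hy : IsTetraPacking y)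
    (i j : Fin 4) (a b : Bool) :
    Q3 (orthoOfTetra y (i, a)) (orthoOfTetra y (j, b)) =
      if a = b then Q2 (y i) (y j) else -2 - Q2 (y i) (y j) := by
  have hS : Q2 (∑ j, y j) (∑ j, y j) = -8 := by
    rw [Q2_sum_right]
    simp only [Q2_comm _ (y _), hy.Q2_sum]
    norm_num
  cases a <;> cases b <;>
    simp only [orthoOfTetra, Q3_liftAt, Q2_sub_left, Q2_sub_right, hS, hy.Q2_sum,
      Q2_comm (∑ j, y j) (y _)] <;>
    norm_num
  ring

theorem IsTetraPacking.isOrthoPacking {y : Fin 4 → Fin 4 → ℝ} (hy : IsTetraPacking y) :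
    IsOrthoPacking (orthoOfTetra y) := by
  refine ⟨?_, ?_, ?_⟩
  · rintro ⟨i, a⟩
    simp [hy.orthoOfTetra_gram, hy.gram]
  · rintro ⟨i, a⟩ ⟨j, b⟩ h1 h2
    have hij : i ≠ j := by
      rintro rfl
      cases a <;> cases b <;> simp_all
    rw [hy.orthoOfTetra_gram, hy.gram, if_neg hij]
    norm_num
  · rintro ⟨i, a⟩
    rw [hy.orthoOfTetra_gram, hy.gram]
    cases a <;> norm_num

/-- The reflection of ℝ⁵ in a unit vector. -/
def reflection3 (w : Fin 5 → ℝ) (hw : Q3 w w = 1) : (Fin 5 → ℝ) ≃ₗ[ℝ] (Fin 5 → ℝ) :=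
  LinearEquiv.ofInvolutive
    { toFun := fun z => z - (2 * Q3 z w) • w
      map_add' := fun a b => by rw [Q3_add_left]; module
      map_smul' := fun t a => by rw [Q3_smul_left]; simp only [RingHom.id_apply]; module }
    fun z => by
      change z - (2 * Q3 z w) • w - (2 * Q3 (z - (2 * Q3 z w) • w) w) • w = z
      rw [Q3_sub_left, Q3_smul_left, hw]
      module

theorem exists_orthoGens_lift {y : Fin 4 → Fin 4 → ℝ} {g : (Fin 4 → ℝ) ≃ₗ[ℝ] (Fin 4 → ℝ)}
    (hg : g ∈ tetraGens y) :
    ∃ h ∈ orthoGens (orthoOfTetra y), ∀ z, h (liftAt 0 z) = liftAt 0 (g z) := by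
  obtain ⟨w, hww, ⟨i, hw⟩, hg⟩ := hg
  have hw3 : Q3 (liftAt 0 w) (liftAt 0 w) = 1 := by rw [Q3_liftAt, hww]; ring
  refine ⟨reflection3 (liftAt 0 w) hw3,
    ⟨liftAt 0 w, hw3, ⟨fun j => decide (j ≠ i), fun j => ?_⟩, fun z => rfl⟩, fun z => ?_⟩
  · by_cases hj : j = i
    · subst hj
      simp only [ne_eq, not_true_eq_false, decide_false, orthoOfTetra, Q3_liftAt, Q2_sub_right,
        Q2_sum_right]
      rw [Finset.sum_eq_single j (fun k _ hk => hw k hk) (by simp)]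
      ring
    · simp [hj, orthoOfTetra, Q3_liftAt, hw]
  · change liftAt 0 z - (2 * Q3 (liftAt 0 z) (liftAt 0 w)) • liftAt 0 w = _
    rw [hg, Q3_liftAt]
    ext k
    fin_cases k <;> simp [liftAt]

theorem liftAt_mem_orthoOmega {y : Fin 4 → Fin 4 → ℝ} {b : Fin 4 → ℝ} (hb : b ∈ tetraOmega y) :
    liftAt 0 b ∈ orthoOmega (orthoOfTetra y) := by
  obtain ⟨g, hg, i, rfl⟩ := hb
  suffices ∃ h ∈ Subgroup.closure (orthoGens (orthoOfTetra y)),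
      ∀ z, h (liftAt 0 z) = liftAt 0 (g z) by
    obtain ⟨h, hh, hz⟩ := this
    exact ⟨h, hh, (i, true), (hz (y i)).symm⟩
  induction hg using Subgroup.closure_induction with
  | mem g hg =>
    obtain ⟨h, hh, hz⟩ := exists_orthoGens_lift hg
    exact ⟨h, Subgroup.subset_closure hh, hz⟩
  | one => exact ⟨1, one_mem _, fun z => rfl⟩
  | mul g₁ g₂ _ _ h₁ h₂ =>
    obtain ⟨k₁, hk₁, hz₁⟩ := h₁
    obtain ⟨k₂, hk₂, hz₂⟩ := h₂
    exact ⟨k₁ * k₂, mul_mem hk₁ hk₂, fun z => by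
      rw [LinearEquiv.mul_apply, LinearEquiv.mul_apply, hz₂, hz₁]⟩
  | inv g _ h =>
    obtain ⟨k, hk, hz⟩ := h
    refine ⟨k⁻¹, inv_mem hk, fun z => ?_⟩
    change k.symm _ = liftAt 0 (g.symm z)
    rw [LinearEquiv.symm_apply_eq, hz, LinearEquiv.apply_symm_apply]

/-- Theorem 1 (tetrahedral case): every tetrahedral Apollonian disk packing has its set of
curvatures contained in the set of curvatures of some orthoplicial Apollonian sphere packing,
and one is integral iff the other is. -/
theorem tetra_section_of_orthoplicial (y : Fin 4 → (Fin 4 → ℝ)) (hy : IsTetraPacking y) :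
    ∃ x : Fin 4 × Bool → (Fin 5 → ℝ), IsOrthoPacking x ∧
      curv2 '' tetraOmega y ⊆ curv3 '' orthoOmega x ∧
      ((∀ b ∈ tetraOmega y, ∃ n : ℤ, curv2 b = n) ↔
        (∀ b ∈ orthoOmega x, ∃ n : ℤ, curv3 b = n)) := by
  refine ⟨orthoOfTetra y, hy.isOrthoPacking, ?_, fun h => ?_, fun h b hb => ?_⟩
  · rintro _ ⟨b, hb, rfl⟩
    exact ⟨liftAt 0 b, liftAt_mem_orthoOmega hb, curv3_liftAt 0 b⟩
  · apply hy.isOrthoPacking.integral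
    have hint (i : Fin 4) : ∃ n : ℤ, curv2 (y i) = n := h _ ⟨1, one_mem _, i, rfl⟩
    choose n hn using hint
    rintro ⟨i, _ | _⟩
    · refine ⟨∑ j, n j - n i, ?_⟩
      simp only [orthoOfTetra, curv3_liftAt, Int.cast_sub, Int.cast_sum, ← hn]
      simp only [curv2, Pi.sub_apply, Finset.sum_apply, Finset.sum_sub_distrib]
      ring
    · exact ⟨n i, by rw [← hn]; exact curv3_liftAt 0 _⟩
  · rw [← curv3_liftAt 0 b]
    exact h _ (liftAt_mem_orthoOmega hb)
end
end

section
/- Theorem 1 (cubical case). For every cubical disk packing y (indexed by the vertices u ∈ {0,1}³ of the cube) there exists an orthoplicial sphere packing x such that the set of curvatures of the cubical Apollonian packing Ω(y) is contained in the set of curvatures of the orthoplicial Apollonian packing Ω(x), i.e. {κ(b) : b ∈ Ω(y)} ⊆ {κ'(b) : b ∈ Ω(x)}; moreover Ω(y) is integral if and only if Ω(x) is integral. -/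
noncomputable section

/-- A cubical disk packing, indexed by the vertices of the cube `{0,1}³`
(here `Fin 3 → Bool`), with inversive products prescribed by Hamming distance. -/
def IsCubicalPacking (y : (Fin 3 → Bool) → (Fin 4 → ℝ)) : Prop :=
  ∀ u v, Q2 (y u) (y v) = 1 - 2 * (hammingDist u v : ℝ)

/-- Generators of the cubical Apollonian group: reflections in vectors orthogonal to the four
disks of a square face (those with a fixed bit in a fixed coordinate). -/
def cubicalGens (y : (Fin 3 → Bool) → (Fin 4 → ℝ)) : Set ((Fin 4 → ℝ) ≃ₗ[ℝ] (Fin 4 → ℝ)) :=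
  {g | ∃ w : Fin 4 → ℝ, Q2 w w = 1 ∧
        (∃ i : Fin 3, ∃ c : Bool, ∀ u, u i = c → Q2 w (y u) = 0) ∧
        ∀ z, g z = z - (2 * Q2 z w) • w}

/-- The cubical Apollonian packing. -/
def cubicalOmega (y : (Fin 3 → Bool) → (Fin 4 → ℝ)) : Set (Fin 4 → ℝ) :=
  {b | ∃ g ∈ Subgroup.closure (cubicalGens y), ∃ u, b = g (y u)}

/-- The vertex of the cube under a vertex of the 16-cell, seen as the demihypercube. -/
def cubeVertex (k : Fin 4 × Bool) : Fin 3 → Bool := fun j => xor k.2 (decide (k.1 = j.succ))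

/-- The parity bit of `cubeVertex k`, i.e. the fourth coordinate of the demihypercube vertex. -/
def cubeParity (k : Fin 4 × Bool) : Bool := xor k.2 (decide (k.1 ≠ 0))

/-- The number in `{1, -1}` encoded by a bit. -/
def bitSign (b : Bool) : ℝ := if b then 1 else -1

/-- A conformal embedding of ℝ⁴ into ℝ⁵ that preserves curvatures and halves the inversive
product; the parameter `t` is the coordinate along the normal of the image. -/
def conformalLift (a : Fin 4 → ℝ) (t : ℝ) : Fin 5 → ℝ :=
  ![a 0 / √2, a 1 / √2, t / √2, (3 * a 2 - a 3) / 4, (3 * a 3 - a 2) / 4]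

/-- The orthoplicial packing that has the packing `y` as a section. -/
def liftPacking (y : (Fin 3 → Bool) → (Fin 4 → ℝ)) (k : Fin 4 × Bool) : Fin 5 → ℝ :=
  conformalLift (y (cubeVertex k)) (bitSign (cubeParity k))

theorem cubeVertex_surjective : Function.Surjective cubeVertex := by decide

theorem hammingDist_cubeVertex (k l : Fin 4 × Bool) :
    hammingDist (cubeVertex k) (cubeVertex l) =
      if l = k then 0 else if l = (k.1, !k.2) then 3
      else if cubeParity k = cubeParity l then 2 else 1 := by
  revert k l; decide

theorem cubeParity_antipode (k : Fin 4 × Bool) : cubeParity (k.1, !k.2) = !cubeParity k := by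
  revert k; decide

theorem curv3_conformalLift (a : Fin 4 → ℝ) (t : ℝ) : curv3 (conformalLift a t) = curv2 a := by
  simp only [curv3, curv2, conformalLift, Matrix.cons_val]
  ring

theorem Q3_conformalLift (a b : Fin 4 → ℝ) (s t : ℝ) :
    Q3 (conformalLift a s) (conformalLift b t) = (Q2 a b + s * t) / 2 := by
  have h : √2 * √2 = (2 : ℝ) := Real.mul_self_sqrt (by norm_num)
  simp only [Q3, Q2, conformalLift, Matrix.cons_val, div_mul_div_comm, h]
  ring

theorem conformalLift_sub_smul (a w : Fin 4 → ℝ) (t r : ℝ) :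
    conformalLift (a - r • w) t = conformalLift a t - r • conformalLift w 0 := by
  ext j
  fin_cases j <;> simp [conformalLift] <;> ring

theorem liftPacking_isOrthoPacking {y : (Fin 3 → Bool) → (Fin 4 → ℝ)} (hy : IsCubicalPacking y) :
    IsOrthoPacking (liftPacking y) := by
  refine ⟨fun k => ?_, fun k l h₁ h₂ => ?_, fun k => ?_⟩
  · rw [liftPacking, Q3_conformalLift, hy, hammingDist_self]
    cases cubeParity k <;> norm_num [bitSign]
  · rw [liftPacking, liftPacking, Q3_conformalLift, hy, hammingDist_cubeVertex, if_neg h₁,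
      if_neg h₂]
    cases cubeParity k <;> cases cubeParity l <;> norm_num [bitSign]
  · rw [liftPacking, liftPacking, Q3_conformalLift, hy, hammingDist_cubeVertex,
      if_neg (by simp [Prod.ext_iff]), if_pos rfl, cubeParity_antipode]
    cases cubeParity k <;> norm_num [bitSign]

/-- The inversive product on ℝ⁵ with a fixed vector, as a linear form. -/
def Q3Linear (v : Fin 5 → ℝ) : (Fin 5 → ℝ) →ₗ[ℝ] ℝ where
  toFun := Q3 v
  map_add' a b := by simp only [Q3, Pi.add_apply]; ring
  map_smul' r a := by simp only [Q3, Pi.smul_apply, smul_eq_mul, RingHom.id_apply]; ring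

@[simp]
theorem Q3Linear_apply (v z : Fin 5 → ℝ) : Q3Linear v z = Q3 v z := rfl

theorem Q3_reflection_involutive {w : Fin 5 → ℝ} (hw : Q3 w w = 1) :
    Function.Involutive fun z : Fin 5 → ℝ => z - (2 * Q3 z w) • w := by
  intro z
  have h : Q3 (z - (2 * Q3 z w) • w) w = - Q3 z w := by
    rw [Q3_comm, ← Q3Linear_apply, map_sub, map_smul]
    simp only [Q3Linear_apply, hw, smul_eq_mul, Q3_comm w z]
    ring
  simp only [h]
  module

/-- The reflection in a unit vector of ℝ⁵. -/
def Q3Reflection (w : Fin 5 → ℝ) (hw : Q3 w w = 1) : (Fin 5 → ℝ) ≃ₗ[ℝ] (Fin 5 → ℝ) :=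
  LinearEquiv.ofInvolutive
    (LinearMap.id - (2 • Q3Linear w).smulRight w) fun z => by
      simpa [Q3_comm w, two_mul, add_smul] using Q3_reflection_involutive hw z

theorem Q3Reflection_apply (w : Fin 5 → ℝ) (hw : Q3 w w = 1) (z : Fin 5 → ℝ) :
    Q3Reflection w hw z = z - (2 * Q3 z w) • w := by
  change z - (2 • Q3Linear w z) • w = _
  rw [Q3Linear_apply, Q3_comm, nsmul_eq_mul, Nat.cast_ofNat]

theorem exists_face_section (i : Fin 3) (c : Bool) :
    ∃ ε : Fin 4 → Bool, ∀ j, cubeVertex (j, ε j) i = c :=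
  ⟨fun j => xor c (decide (j = i.succ)), fun j => by simp [cubeVertex]⟩

theorem exists_orthoGens_lift_s2 {y : (Fin 3 → Bool) → (Fin 4 → ℝ)}
    {g : (Fin 4 → ℝ) ≃ₗ[ℝ] (Fin 4 → ℝ)} (hg : g ∈ cubicalGens y) :
    ∃ G ∈ orthoGens (liftPacking y), ∀ a t, G (conformalLift a t) = conformalLift (g a) t := by
  obtain ⟨w, hw, ⟨i, c, hic⟩, hgw⟩ := hg
  have h2 : √2 * √2 = (2 : ℝ) := Real.mul_self_sqrt (by norm_num)
  have hQ (a : Fin 4 → ℝ) (t : ℝ) :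
      Q3 (conformalLift a t) (√2 • conformalLift w 0) = √2 * (Q2 a w / 2) := by
    rw [← Q3Linear_apply, map_smul, Q3Linear_apply, Q3_conformalLift, mul_zero, add_zero,
      smul_eq_mul]
  have hcomm (a b : Fin 4 → ℝ) : Q2 a b = Q2 b a := by simp only [Q2]; ring
  have hW : Q3 (√2 • conformalLift w 0) (√2 • conformalLift w 0) = 1 := by
    rw [← Q3Linear_apply, map_smul, Q3Linear_apply, Q3_comm, hQ, hw, smul_eq_mul]
    linarith
  obtain ⟨ε, hε⟩ := exists_face_section i c
  refine ⟨Q3Reflection _ hW, ⟨_, hW, ⟨ε, fun j => ?_⟩, Q3Reflection_apply _ hW⟩, fun a t => ?_⟩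
  · rw [Q3_comm, liftPacking, hQ, hcomm, hic _ (hε j), zero_div, mul_zero]
  · rw [Q3Reflection_apply, hQ, hgw, conformalLift_sub_smul, smul_smul]
    congr 2
    linear_combination Q2 a w * h2

theorem exists_closure_orthoGens_lift {y : (Fin 3 → Bool) → (Fin 4 → ℝ)}
    {g : (Fin 4 → ℝ) ≃ₗ[ℝ] (Fin 4 → ℝ)} (hg : g ∈ Subgroup.closure (cubicalGens y)) :
    ∃ G ∈ Subgroup.closure (orthoGens (liftPacking y)),
      ∀ a t, G (conformalLift a t) = conformalLift (g a) t := by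
  induction hg using Subgroup.closure_induction with
  | mem g hg =>
    obtain ⟨G, hG, h⟩ := exists_orthoGens_lift_s2 hg
    exact ⟨G, Subgroup.subset_closure hG, h⟩
  | one => exact ⟨1, one_mem _, fun _ _ => rfl⟩
  | mul g₁ g₂ _ _ ih₁ ih₂ =>
    obtain ⟨G₁, hG₁, h₁⟩ := ih₁
    obtain ⟨G₂, hG₂, h₂⟩ := ih₂
    exact ⟨G₁ * G₂, mul_mem hG₁ hG₂, fun a t => by simp only [LinearEquiv.mul_apply, h₁, h₂]⟩
  | inv g _ ih =>
    obtain ⟨G, hG, h⟩ := ih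
    refine ⟨G⁻¹, inv_mem hG, fun a t => ?_⟩
    have key := h (g⁻¹ a) t
    rw [show g (g⁻¹ a) = a from g.apply_symm_apply a] at key
    rw [← key]
    exact G.symm_apply_apply _

theorem curv2_image_subset (y : (Fin 3 → Bool) → (Fin 4 → ℝ)) :
    curv2 '' cubicalOmega y ⊆ curv3 '' orthoOmega (liftPacking y) := by
  rintro _ ⟨_, ⟨g, hg, u, rfl⟩, rfl⟩
  obtain ⟨G, hG, h⟩ := exists_closure_orthoGens_lift hg
  obtain ⟨k, rfl⟩ := cubeVertex_surjective u
  exact ⟨_, ⟨G, hG, k, rfl⟩, by rw [liftPacking, h, curv3_conformalLift]⟩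

theorem eq_zero_of_Q3_eq_zero {v : Fin 5 → ℝ} (h : ∀ z, Q3 v z = 0) : v = 0 := by
  ext j
  have := h (Pi.single j 1)
  fin_cases j <;> simpa [Q3] using this

theorem IsOrthoPacking.facet_gram {x : Fin 4 × Bool → (Fin 5 → ℝ)} (hx : IsOrthoPacking x)
    (ε : Fin 4 → Bool) (j l : Fin 4) :
    Q3 (x (j, ε j)) (x (l, ε l)) = if j = l then 1 else -1 := by
  split_ifs with h
  · rw [h]
    exact hx.1 _
  · exact hx.2.1 _ _ (by simp [Ne.symm h]) (by simp [Ne.symm h])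

theorem IsOrthoPacking.antipode_facet_gram {x : Fin 4 × Bool → (Fin 5 → ℝ)}
    (hx : IsOrthoPacking x) (ε : Fin 4 → Bool) (i l : Fin 4) :
    Q3 (x (i, !ε i)) (x (l, ε l)) = if i = l then -3 else -1 := by
  split_ifs with h
  · rw [← h]
    simpa using hx.2.2 (i, !ε i)
  · exact hx.2.1 _ _ (by simp [Ne.symm h]) (by simp [Ne.symm h])

theorem sum_ite_eq_neg_one (i : Fin 4) (r : ℝ) : ∑ j, (if i = j then r else -1) = r - 3 := by
  rw [Finset.sum_eq_add_sum_sdiff_singleton_of_mem (Finset.mem_univ i), if_pos rfl,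
    Finset.sum_congr rfl (g := fun _ => (-1 : ℝ))]
  · simp [Finset.card_sdiff]
    ring
  · intro j hj
    rw [if_neg]
    rintro rfl
    simp at hj

/-- A facet of an orthoplicial packing together with one further sphere spans ℝ⁵. -/
theorem eq_zero_of_orthogonal_facet {x : Fin 4 × Bool → (Fin 5 → ℝ)} (hx : IsOrthoPacking x)
    (ε : Fin 4 → Bool) (i : Fin 4) {v : Fin 5 → ℝ} (hv : ∀ j, Q3 v (x (j, ε j)) = 0)
    (hi : Q3 v (x (i, !ε i)) = 0) : v = 0 := by
  let b : Option (Fin 4) → (Fin 5 → ℝ) := fun o => o.elim (x (i, !ε i)) fun j => x (j, ε j)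
  have hli : LinearIndependent ℝ b := by
    rw [Fintype.linearIndependent_iff]
    intro c hc
    have hz (z : Fin 5 → ℝ) :
        c none * Q3 z (x (i, !ε i)) + ∑ j, c (some j) * Q3 z (x (j, ε j)) = 0 := by
      have := congrArg (Q3Linear z) hc
      rw [map_zero, map_sum, Fintype.sum_option] at this
      simp only [map_smul, Q3Linear_apply, smul_eq_mul] at this
      exact this
    have h₀ := hz (x (i, !ε i))
    have h₁ := hz (x (0, ε 0))
    have h₂ := hz (x (1, ε 1))
    have h₃ := hz (x (2, ε 2))
    have h₄ := hz (x (3, ε 3))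
    simp only [hx.1, hx.facet_gram, hx.antipode_facet_gram, Q3_comm _ (x (i, !ε i)),
      Fin.sum_univ_four] at h₀ h₁ h₂ h₃ h₄
    rintro (_ | j)
    · fin_cases i <;> simp at h₀ h₁ h₂ h₃ h₄ <;> linarith
    · fin_cases i <;> simp at h₀ h₁ h₂ h₃ h₄ <;> fin_cases j <;> simp <;> linarith
  have hspan : Submodule.span ℝ (Set.range b) = ⊤ :=
    hli.span_eq_top_of_card_eq_finrank' (by simp)
  apply eq_zero_of_Q3_eq_zero
  have hle : Submodule.span ℝ (Set.range b) ≤ LinearMap.ker (Q3Linear v) := by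
    rw [Submodule.span_le]
    rintro _ ⟨_ | j, rfl⟩
    exacts [hi, hv j]
  intro z
  exact hle (hspan ▸ Submodule.mem_top)

theorem orthoGens_apply_self {x : Fin 4 × Bool → (Fin 5 → ℝ)} (hx : IsOrthoPacking x)
    {g : (Fin 5 → ℝ) ≃ₗ[ℝ] (Fin 5 → ℝ)} (hg : g ∈ orthoGens x) (k : Fin 4 × Bool) :
    g (x k) ∈ AddSubgroup.closure (Set.range x) := by
  obtain ⟨w, hw, ⟨ε, hε⟩, hgw⟩ := hg
  have hmem (k) : x k ∈ AddSubgroup.closure (Set.range x) := AddSubgroup.subset_closure ⟨k, rfl⟩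
  obtain ⟨i, c⟩ := k
  by_cases hc : c = ε i
  · rw [hgw, hc, Q3_comm, hε]
    simpa using hmem _
  obtain rfl : c = !ε i := by rwa [Bool.eq_not]
  set u := ∑ j, x (j, ε j) - x (i, ε i) - x (i, !ε i) with hu
  have hQu (z : Fin 5 → ℝ) :
      Q3 z u = ∑ j, Q3 z (x (j, ε j)) - Q3 z (x (i, ε i)) - Q3 z (x (i, !ε i)) := by
    simp only [← Q3Linear_apply, hu, map_sub, map_sum]
  set q := Q3 w (x (i, !ε i)) with hq
  have hwu : Q3 w u = -q := by
    rw [hQu, hε, Finset.sum_eq_zero fun j _ => hε j, ← hq]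
    ring
  have huj (j : Fin 4) : Q3 (x (j, ε j)) u = 0 := by
    rw [hQu, Q3_comm _ (x (i, !ε i))]
    simp only [hx.facet_gram, hx.antipode_facet_gram, sum_ite_eq_neg_one, eq_comm (a := i)]
    split_ifs <;> norm_num
  have hui : Q3 (x (i, !ε i)) u = -4 := by
    rw [hQu]
    simp only [hx.1, hx.antipode_facet_gram, sum_ite_eq_neg_one, if_true]
    norm_num
  have hQv (z : Fin 5 → ℝ) : Q3 (w + (q / 4) • u) z = Q3 w z + q / 4 * Q3 z u := by
    rw [Q3_comm, ← Q3Linear_apply, map_add, map_smul, Q3Linear_apply, Q3Linear_apply,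
      Q3_comm z w, smul_eq_mul]
  have hv : w + (q / 4) • u = 0 := by
    refine eq_zero_of_orthogonal_facet hx ε i (fun j => ?_) ?_
    · rw [hQv, hε, huj]
      ring
    · rw [hQv, hui, ← hq]
      ring
  have hwq : w = (-(q / 4)) • u := by
    rw [neg_smul]
    exact eq_neg_of_add_eq_zero_left hv
  have hqq : q * q = 4 := by
    have h := hQv w
    rw [hv, hw, hwu, Q3_comm, ← Q3Linear_apply, map_zero] at h
    linarith
  have hg : g (x (i, !ε i)) = x (i, !ε i) + (2 : ℕ) • u := by
    rw [hgw, Q3_comm, ← hq, hwq, smul_smul, show 2 * q * -(q / 4) = -2 by linarith]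
    module
  rw [hg]
  exact add_mem (hmem _)
    (nsmul_mem (sub_mem (sub_mem (sum_mem fun j _ => hmem _) (hmem _)) (hmem _)) 2)

theorem orthoOmega_subset_closure {x : Fin 4 × Bool → (Fin 5 → ℝ)} (hx : IsOrthoPacking x) :
    orthoOmega x ⊆ AddSubgroup.closure (Set.range x) := by
  set L := AddSubgroup.closure (Set.range x) with hL
  have hgen {g : (Fin 5 → ℝ) ≃ₗ[ℝ] (Fin 5 → ℝ)} (hg : g ∈ orthoGens x) :
      ∀ z ∈ L, g z ∈ L := by
    have : L ≤ L.comap (g : (Fin 5 → ℝ) →+ (Fin 5 → ℝ)) := by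
      rw [hL, AddSubgroup.closure_le]
      rintro _ ⟨k, rfl⟩
      exact orthoGens_apply_self hx hg k
    exact this
  have hinv {g : (Fin 5 → ℝ) ≃ₗ[ℝ] (Fin 5 → ℝ)} (hg : g ∈ orthoGens x) : g⁻¹ = g := by
    obtain ⟨w, hw, -, hgw⟩ := hg
    rw [inv_eq_iff_mul_eq_one]
    ext1 z
    simpa [hgw] using Q3_reflection_involutive hw z
  rintro _ ⟨g, hg, k, rfl⟩
  suffices h : ∀ z ∈ L, g z ∈ L from h _ (AddSubgroup.subset_closure ⟨k, rfl⟩)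
  induction hg using Subgroup.closure_induction'' with
  | mem g hg => exact hgen hg
  | inv_mem g hg => rw [hinv hg]; exact hgen hg
  | one => exact fun z hz => hz
  | mul g₁ g₂ _ _ h₁ h₂ => exact fun z hz => h₁ _ (h₂ z hz)

theorem orthoOmega_integral {x : Fin 4 × Bool → (Fin 5 → ℝ)} (hx : IsOrthoPacking x)
    (h : ∀ k, ∃ n : ℤ, curv3 (x k) = n) : ∀ b ∈ orthoOmega x, ∃ n : ℤ, curv3 b = n := by
  intro b hb
  have hbL := orthoOmega_subset_closure hx hb
  clear hb
  induction hbL using AddSubgroup.closure_induction with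
  | mem z hz => obtain ⟨k, rfl⟩ := hz; exact h k
  | zero => exact ⟨0, by simp [curv3]⟩
  | add a b _ _ ha hb =>
    obtain ⟨m, hm⟩ := ha
    obtain ⟨n, hn⟩ := hb
    exact ⟨m + n, by push_cast; rw [← hm, ← hn]; simp only [curv3, Pi.add_apply]; ring⟩
  | neg a _ ha =>
    obtain ⟨m, hm⟩ := ha
    exact ⟨-m, by push_cast; rw [← hm]; simp only [curv3, Pi.neg_apply]; ring⟩

/-- Theorem 1 (cubical case): every cubical Apollonian disk packing has its set of
curvatures contained in the set of curvatures of some orthoplicial Apollonian sphere packing,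
and one is integral iff the other is. -/
theorem cubical_section_of_orthoplicial (y : (Fin 3 → Bool) → (Fin 4 → ℝ))
    (hy : IsCubicalPacking y) :
    ∃ x : Fin 4 × Bool → (Fin 5 → ℝ), IsOrthoPacking x ∧
      curv2 '' cubicalOmega y ⊆ curv3 '' orthoOmega x ∧
      ((∀ b ∈ cubicalOmega y, ∃ n : ℤ, curv2 b = n) ↔
        (∀ b ∈ orthoOmega x, ∃ n : ℤ, curv3 b = n)) := by
  have hx := liftPacking_isOrthoPacking hy
  refine ⟨liftPacking y, hx, curv2_image_subset y, fun h => ?_, fun h b hb => ?_⟩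
  · refine orthoOmega_integral hx fun k => ?_
    rw [liftPacking, curv3_conformalLift]
    exact h _ ⟨1, one_mem _, cubeVertex k, rfl⟩
  · obtain ⟨b', hb', hbb'⟩ := curv2_image_subset y ⟨b, hb, rfl⟩
    rw [← hbb']
    exact h b' hb'
end
end

section
/- Generalized octahedral Descartes theorem (generalization of Guettler–Mallows to every dimension). Let d ≥ 2 and let x be a (d+1)-cross-polytope ball packing in ℝ^{d+2}. Fix signs ε₁,…,ε_{d+1} ∈ {+1,−1}, so that x_{ε₁·1},…,x_{ε_{d+1}·(d+1)} are the inversive coordinates of d+1 pairwise tangent d-balls, and set κ_O := (κ(x₁) + κ(x₋₁))/2. Then Σ_{i=1}^{d+1} (κ(x_{εᵢ·i}) − κ_O)² = 2·κ_O². -/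
noncomputable section

open Finset

/-- Inversive product on ℝ^{d+2}: sum of products of the first d+1 coordinates minus the
product of the last ones. -/
def Qd (d : ℕ) (a b : Fin (d + 2) → ℝ) : ℝ :=
  (∑ i : Fin (d + 1), a i.castSucc * b i.castSucc) -
    a (Fin.last (d + 1)) * b (Fin.last (d + 1))

/-- Curvature of a d-ball in inversive coordinates: last coordinate minus the previous one. -/
def curvd (d : ℕ) (a : Fin (d + 2) → ℝ) : ℝ :=
  a (Fin.last (d + 1)) - a ((Fin.last d).castSucc)

/-- A (d+1)-cross-polytope ball packing, indexed by `{±1,…,±(d+1)}`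
(here `Fin (d+1) × Bool`, with negation flipping the boolean). -/
def IsCrossPacking (d : ℕ) (x : Fin (d + 1) × Bool → (Fin (d + 2) → ℝ)) : Prop :=
  (∀ k, Qd d (x k) (x k) = 1) ∧
  (∀ k l, l ≠ k → l ≠ (k.1, !k.2) → Qd d (x k) (x l) = -1) ∧
  (∀ k, Qd d (x k) (x (k.1, !k.2)) = -3)

theorem Qd_comm (d : ℕ) (a b : Fin (d + 2) → ℝ) : Qd d a b = Qd d b a := by
  simp only [Qd, mul_comm]

theorem Qd_add_left (d : ℕ) (a b c : Fin (d + 2) → ℝ) :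
    Qd d (a + b) c = Qd d a c + Qd d b c := by
  simp only [Qd, Pi.add_apply, add_mul, sum_add_distrib]
  ring

theorem Qd_smul_left (d : ℕ) (r : ℝ) (a b : Fin (d + 2) → ℝ) :
    Qd d (r • a) b = r * Qd d a b := by
  simp only [Qd, Pi.smul_apply, smul_eq_mul, mul_assoc, ← mul_sum, mul_sub]

theorem Qd_sub_left (d : ℕ) (a b c : Fin (d + 2) → ℝ) :
    Qd d (a - b) c = Qd d a c - Qd d b c := by
  rw [eq_sub_iff_add_eq, ← Qd_add_left, sub_add_cancel]

theorem Qd_add_right (d : ℕ) (a b c : Fin (d + 2) → ℝ) :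
    Qd d a (b + c) = Qd d a b + Qd d a c := by
  simp only [Qd_comm d a, Qd_add_left]

theorem Qd_sub_right (d : ℕ) (a b c : Fin (d + 2) → ℝ) :
    Qd d a (b - c) = Qd d a b - Qd d a c := by
  simp only [Qd_comm d a, Qd_sub_left]

theorem Qd_smul_right (d : ℕ) (r : ℝ) (a b : Fin (d + 2) → ℝ) :
    Qd d a (r • b) = r * Qd d a b := by
  simp only [Qd_comm d a, Qd_smul_left]

/-- The Gram matrix of the inversive product. -/
def inversiveGram (d : ℕ) : Matrix (Fin (d + 2)) (Fin (d + 2)) ℝ :=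
  Matrix.diagonal (Fin.snoc (fun _ => 1) (-1))

theorem Qd_eq_dotProduct (d : ℕ) (a b : Fin (d + 2) → ℝ) :
    Qd d a b = a ⬝ᵥ (inversiveGram d).mulVec b := by
  simp [Qd, inversiveGram, dotProduct, Matrix.mulVec_diagonal, Fin.sum_univ_castSucc,
    sub_eq_add_neg]

/-- Parseval's identity for the inversive product and an orthogonal family of `d + 2`
non-isotropic vectors. -/
theorem Qd_eq_sum_of_orthogonal (d : ℕ) (b : Fin (d + 2) → Fin (d + 2) → ℝ)
    (g : Fin (d + 2) → ℝ) (hg : ∀ i, g i ≠ 0) (hdiag : ∀ i, Qd d (b i) (b i) = g i)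
    (hoff : ∀ i j, i ≠ j → Qd d (b i) (b j) = 0) (v w : Fin (d + 2) → ℝ) :
    Qd d v w = ∑ i, Qd d v (b i) * (g i)⁻¹ * Qd d (b i) w := by
  set J := inversiveGram d
  let B : Matrix (Fin (d + 2)) (Fin (d + 2)) ℝ := Matrix.of b
  have hB (u : Fin (d + 2) → ℝ) (i : Fin (d + 2)) : (B * J).mulVec u i = Qd d (b i) u := by
    rw [Qd_eq_dotProduct, ← Matrix.mulVec_mulVec]
    rfl
  have hG : (B * J) * B.transpose = Matrix.diagonal g := by
    ext i j
    rw [show ((B * J) * B.transpose) i j = (B * J).mulVec (b j) i from rfl, hB]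
    rcases eq_or_ne i j with rfl | hij
    · simp [hdiag]
    · simp [hoff i j hij, hij]
  have hinv : (B.transpose * Matrix.diagonal g⁻¹) * (B * J) = 1 := by
    apply mul_eq_one_comm.mp
    rw [← Matrix.mul_assoc, hG, Matrix.diagonal_mul_diagonal]
    simp [hg]
  calc Qd d v w = Qd d w (((B.transpose * Matrix.diagonal g⁻¹) * (B * J)).mulVec v) := by
        rw [hinv, Matrix.one_mulVec, Qd_comm]
    _ = (B * J).mulVec w ⬝ᵥ (Matrix.diagonal g⁻¹).mulVec ((B * J).mulVec v) := by
        rw [Qd_comm, Qd_eq_dotProduct, dotProduct_comm, Matrix.mul_assoc,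
          ← Matrix.mulVec_mulVec, Matrix.dotProduct_mulVec, Matrix.vecMul_transpose,
          Matrix.mulVec_mulVec, ← Matrix.mulVec_mulVec v]
    _ = _ := by
        simp only [dotProduct, Matrix.mulVec_diagonal, hB, Pi.inv_apply]
        refine sum_congr rfl fun i _ => ?_
        rw [Qd_comm d v]
        ring

/-- The isotropic vector representing the curvature through the inversive product. -/
def curvVec (d : ℕ) : Fin (d + 2) → ℝ :=
  Fin.snoc (Fin.snoc (fun _ => 0) (-1)) (-1)

theorem Qd_curvVec (d : ℕ) (a : Fin (d + 2) → ℝ) : Qd d a (curvVec d) = curvd d a := by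
  simp [Qd, curvVec, curvd, Fin.sum_univ_castSucc]
  ring

theorem curvd_curvVec (d : ℕ) : curvd d (curvVec d) = 0 := by
  simp [curvVec, curvd]

/-- The octahedral Descartes identity for `d + 1` antipodal pairs `(y i, z i)`, together with
the equality of the mean curvatures of all the pairs. -/
theorem sum_sq_curvd_sub_of_antipodal (d : ℕ) (y z : Fin (d + 1) → Fin (d + 2) → ℝ)
    (hyy : ∀ i, Qd d (y i) (y i) = 1) (hzz : ∀ i, Qd d (z i) (z i) = 1)
    (hyz : ∀ i, Qd d (y i) (z i) = -3)
    (hyy' : ∀ i j, i ≠ j → Qd d (y i) (y j) = -1)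
    (hzz' : ∀ i j, i ≠ j → Qd d (z i) (z j) = -1)
    (hyz' : ∀ i j, i ≠ j → Qd d (y i) (z j) = -1) (κ : ℝ)
    (hκ : κ = (curvd d (y 0) + curvd d (z 0)) / 2) :
    ∑ i, (curvd d (y i) - κ) ^ 2 = 2 * κ ^ 2 := by
  have hzy (i) : Qd d (z i) (y i) = -3 := by rw [Qd_comm, hyz]
  have hzy' (i j) (h : i ≠ j) : Qd d (z i) (y j) = -1 := by rw [Qd_comm, hyz' j i h.symm]
  let m (i : Fin (d + 1)) := (1 / 2 : ℝ) • (y i + z i)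
  let u (i : Fin (d + 1)) := (1 / 2 : ℝ) • (y i - z i)
  have hmm (i j) : Qd d (m i) (m j) = -1 := by
    simp only [m, Qd_smul_left, Qd_smul_right, Qd_add_left, Qd_add_right]
    rcases eq_or_ne i j with rfl | h
    · rw [hyy, hyz, hzy, hzz]; norm_num
    · rw [hyy' i j h, hyz' i j h, hzy' i j h, hzz' i j h]; norm_num
  have hmu (i j) : Qd d (m i) (u j) = 0 := by
    simp only [m, u, Qd_smul_left, Qd_smul_right, Qd_add_left, Qd_sub_right]
    rcases eq_or_ne i j with rfl | h
    · rw [hyy, hyz, hzy, hzz]; norm_num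
    · rw [hyy' i j h, hyz' i j h, hzy' i j h, hzz' i j h]; norm_num
  have huu (i) : Qd d (u i) (u i) = 2 := by
    simp only [u, Qd_smul_left, Qd_smul_right, Qd_sub_left, Qd_sub_right]
    rw [hyy, hyz, hzy, hzz]; norm_num
  have huu' (i j) (h : i ≠ j) : Qd d (u i) (u j) = 0 := by
    simp only [u, Qd_smul_left, Qd_smul_right, Qd_sub_left, Qd_sub_right]
    rw [hyy' i j h, hyz' i j h, hzy' i j h, hzz' i j h]; norm_num
  have parseval (v w : Fin (d + 2) → ℝ) :
      Qd d v w = -(Qd d v (m 0) * Qd d (m 0) w) + ∑ i, Qd d v (u i) * 2⁻¹ * Qd d (u i) w := by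
    rw [Qd_eq_sum_of_orthogonal d (Fin.cons (m 0) u) (Fin.cons (-1) fun _ => 2), Fin.sum_univ_succ]
    · norm_num
    · refine Fin.cases ?_ fun i => ?_ <;> norm_num
    · refine Fin.cases ?_ fun i => ?_ <;> simp [hmm, huu]
    · refine Fin.cases (Fin.cases ?_ fun j => ?_) fun i => Fin.cases ?_ fun j => ?_
      · simp
      · simp [hmu]
      · simp [Qd_comm d (u i), hmu]
      · intro h
        simpa using huu' i j (by simpa using h)
  have hm (i) : curvd d (m i) = κ := by
    have h0 : curvd d (m 0) = κ := by
      simp only [hκ, ← Qd_curvVec, m, Qd_smul_left, Qd_add_left]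
      ring
    rw [← h0, ← Qd_curvVec, parseval]
    simp [hmm, hmu, Qd_curvVec]
  have hu (i) : curvd d (u i) = curvd d (y i) - κ := by
    rw [← hm i]
    simp only [← Qd_curvVec, m, u, Qd_smul_left, Qd_add_left, Qd_sub_left]
    ring
  have h := parseval (curvVec d) (curvVec d)
  simp only [Qd_comm d (curvVec d), Qd_curvVec, curvd_curvVec, hm, hu] at h
  have hsum : ∑ i, (curvd d (y i) - κ) * 2⁻¹ * (curvd d (y i) - κ) =
      2⁻¹ * ∑ i, (curvd d (y i) - κ) ^ 2 := by
    rw [mul_sum]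
    exact sum_congr rfl fun i _ => by ring
  rw [hsum] at h
  linarith

/-- Generalized octahedral Descartes theorem (Guettler–Mallows in every dimension):
for d+1 pairwise tangent balls of a (d+1)-cross-polytope packing, one from each antipodal
pair, the curvatures satisfy `∑ (κᵢ − κ_O)² = 2 κ_O²`, where `κ_O` is the mean curvature of
an antipodal pair. -/
theorem generalized_octahedral_descartes (d : ℕ) (hd : 2 ≤ d)
    (x : Fin (d + 1) × Bool → (Fin (d + 2) → ℝ)) (hx : IsCrossPacking d x)
    (ε : Fin (d + 1) → Bool) (κO : ℝ)
    (hκO : κO = (curvd d (x (0, true)) + curvd d (x (0, false))) / 2) :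
    ∑ i : Fin (d + 1), (curvd d (x (i, ε i)) - κO) ^ 2 = 2 * κO ^ 2 := by
  obtain ⟨hself, htan, hanti⟩ := hx
  have cross (i j : Fin (d + 1)) (h : i ≠ j) (a b : Bool) : Qd d (x (i, a)) (x (j, b)) = -1 :=
    htan _ _ (by simp [h.symm]) (by simp [h.symm])
  refine sum_sq_curvd_sub_of_antipodal d (fun i => x (i, ε i)) (fun i => x (i, !ε i))
    (fun _ => hself _) (fun _ => hself _) (fun i => hanti (i, ε i))
    (fun i j h => cross i j h _ _) (fun i j h => cross i j h _ _)
    (fun i j h => cross i j h _ _) κO ?_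
  rw [hκO]
  cases ε 0 <;> simp [add_comm]
end
end

section
/- Soddy–Gosset theorem (inversive-coordinate form). Let d ≥ 1 and let x₁,…,x_{d+2} ∈ ℝ^{d+2} satisfy Q(xᵢ,xᵢ) = 1 for all i and Q(xᵢ,xⱼ) = −1 for all i ≠ j (these are the inversive coordinates of d+2 pairwise tangent d-balls). Then, with κᵢ := κ(xᵢ), one has d·Σ_{i=1}^{d+2} κᵢ² = (Σ_{i=1}^{d+2} κᵢ)². -/
noncomputable section

open Finset

/-- The signature of the inversive product. -/
def inversiveSign (d : ℕ) (a : Fin (d + 2)) : ℝ :=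
  if a = Fin.last (d + 1) then -1 else 1

theorem inversiveSign_mul_self (d : ℕ) (a : Fin (d + 2)) :
    inversiveSign d a * inversiveSign d a = 1 := by
  unfold inversiveSign
  split_ifs <;> norm_num

theorem Qd_eq_sum_inversiveSign (d : ℕ) (a b : Fin (d + 2) → ℝ) :
    Qd d a b = ∑ i, a i * inversiveSign d i * b i := by
  rw [Fin.sum_univ_castSucc]
  simp [Qd, inversiveSign, Fin.castSucc_ne_last, sub_eq_add_neg]

/-- The dual relation between the coordinates of `d + 2` pairwise tangent balls, obtained by
inverting their Gram matrix. -/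
theorem sum_coord_mul_coord_of_tangent (d : ℕ) (hd : 1 ≤ d)
    (x : Fin (d + 2) → (Fin (d + 2) → ℝ))
    (hnorm : ∀ i, Qd d (x i) (x i) = 1)
    (htan : ∀ i j, i ≠ j → Qd d (x i) (x j) = -1) (a b : Fin (d + 2)) :
    d * ∑ i, x i a * x i b - (∑ i, x i a) * ∑ i, x i b =
      if a = b then 2 * d * inversiveSign d a else 0 := by
  have hd0 : (d : ℝ) ≠ 0 := by positivity
  let A : Matrix (Fin (d + 2)) (Fin (d + 2)) ℝ := fun a j =>
    inversiveSign d a * (d * x j a - ∑ i, x i a) / (2 * d)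
  have hgram (i j) : ∑ a, x i a * inversiveSign d a * x j a = if i = j then 1 else -1 := by
    rw [← Qd_eq_sum_inversiveSign]
    split_ifs with h
    · rw [h, hnorm]
    · exact htan i j h
  have hrow (i : Fin (d + 2)) : ∑ k, (if i = k then (1 : ℝ) else -1) = -d := by
    have h (k : Fin (d + 2)) : (if i = k then (1 : ℝ) else -1) = (if i = k then 2 else 0) - 1 := by
      split_ifs <;> norm_num
    simp only [h, Finset.sum_sub_distrib]
    simp
  have hXA : Matrix.of x * A = 1 := by
    ext i j
    calc ∑ a, x i a * (inversiveSign d a * (d * x j a - ∑ k, x k a) / (2 * d))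
        = (d * ∑ a, x i a * inversiveSign d a * x j a
            - ∑ k, ∑ a, x i a * inversiveSign d a * x k a) / (2 * d) := by
          rw [Finset.sum_comm, Finset.mul_sum, ← Finset.sum_sub_distrib, Finset.sum_div]
          refine Finset.sum_congr rfl fun a _ => ?_
          rw [← Finset.mul_sum]
          ring
      _ = (1 : Matrix (Fin (d + 2)) (Fin (d + 2)) ℝ) i j := by
          simp only [hgram, hrow, Matrix.one_apply]
          split_ifs <;> field_simp <;> ring
  have hAX : (A * Matrix.of x) a b = (1 : Matrix (Fin (d + 2)) (Fin (d + 2)) ℝ) a b := by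
    rw [mul_eq_one_comm.mp hXA]
  have hsum : (A * Matrix.of x) a b = inversiveSign d a *
      (d * ∑ i, x i a * x i b - (∑ i, x i a) * ∑ i, x i b) / (2 * d) := by
    rw [Matrix.mul_apply, Finset.mul_sum, Finset.mul_sum, ← Finset.sum_sub_distrib,
      Finset.mul_sum, Finset.sum_div]
    refine Finset.sum_congr rfl fun i _ => ?_
    simp only [A, Matrix.of_apply]
    ring
  rw [hsum, Matrix.one_apply, div_eq_iff (by positivity)] at hAX
  have hs := inversiveSign_mul_self d a
  rw [← one_mul (_ - _), ← hs, mul_assoc, hAX]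
  split_ifs <;> ring

/-- Soddy–Gosset theorem in inversive coordinates: the curvatures of d+2 pairwise tangent
d-balls satisfy `d·∑ κᵢ² = (∑ κᵢ)²`. -/
theorem soddy_gosset (d : ℕ) (hd : 1 ≤ d) (x : Fin (d + 2) → (Fin (d + 2) → ℝ))
    (hnorm : ∀ i, Qd d (x i) (x i) = 1)
    (htan : ∀ i j, i ≠ j → Qd d (x i) (x j) = -1) :
    (d : ℝ) * ∑ i : Fin (d + 2), (curvd d (x i)) ^ 2 =
      (∑ i : Fin (d + 2), curvd d (x i)) ^ 2 := by
  have h := sum_coord_mul_coord_of_tangent d hd x hnorm htan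
  have hne : (Fin.last d).castSucc ≠ Fin.last (d + 1) := Fin.castSucc_ne_last _
  have hll := h (Fin.last (d + 1)) (Fin.last (d + 1))
  have hpp := h (Fin.last d).castSucc (Fin.last d).castSucc
  have hpl := h (Fin.last d).castSucc (Fin.last (d + 1))
  simp only [if_true, if_neg hne, inversiveSign] at hll hpp hpl
  have hsq : ∑ i, curvd d (x i) ^ 2 =
      ∑ i, x i (Fin.last (d + 1)) * x i (Fin.last (d + 1))
        - 2 * ∑ i, x i (Fin.last d).castSucc * x i (Fin.last (d + 1))
        + ∑ i, x i (Fin.last d).castSucc * x i (Fin.last d).castSucc := by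
    rw [Finset.mul_sum, ← Finset.sum_sub_distrib, ← Finset.sum_add_distrib]
    refine Finset.sum_congr rfl fun i _ => ?_
    unfold curvd
    ring
  rw [hsq]
  simp only [curvd, Finset.sum_sub_distrib]
  linear_combination hll + hpp - 2 * hpl
end
end

section
/- Hypercubical Descartes theorem. Let d ≥ 1, let x be a (d+1)-cube ball packing in ℝ^{d+2}, and let u₁,…,u_{d+2} ∈ {0,1}^{d+1} be vertices with h(uᵢ,uᵢ₊₁) = 1 for i = 1,…,d+1 and h(u₁,u_{d+2}) = d+1 (so the corresponding d-balls are consecutively tangent and the first and last are at graph distance d+1 in the cube graph). Then, with κᵢ := κ(x_{uᵢ}), one has d·Σ_{i=1}^{d+1} (κᵢ − κᵢ₊₁)² = (κ₁ + κ_{d+2})². -/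
noncomputable section

open Finset

/-- A (d+1)-cube ball packing, indexed by the vertices `{0,1}^{d+1}` of the (d+1)-cube
(here `Fin (d+1) → Bool`), with inversive products prescribed by Hamming distance. -/
def IsCubePacking (d : ℕ) (x : (Fin (d + 1) → Bool) → (Fin (d + 2) → ℝ)) : Prop :=
  ∀ u v, Qd d (x u) (x v) = 1 - 2 * (hammingDist u v : ℝ)

/-- Parseval's identity for a bilinear form with an orthogonal basis. -/
theorem Module.Basis.bilinForm_self_eq_sum_sq_div {ι K V : Type*} [Fintype ι] [Field K]
    [AddCommGroup V] [Module K V] (B : LinearMap.BilinForm K V) (b : Module.Basis ι K V)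
    (hb : B.IsOrthoᵢ b) (hw : ∀ i, B (b i) (b i) ≠ 0) (v : V) :
    B v v = ∑ i, B (b i) v ^ 2 / B (b i) (b i) := by
  have key (i : ι) : B (b i) v = b.repr v i * B (b i) (b i) := by
    conv_lhs => rw [← b.sum_repr v]
    rw [map_sum, Finset.sum_eq_single i]
    · simp
    · intro j _ hj
      have h : B (b i) (b j) = 0 := hb hj.symm
      simp [h]
    · simp
  have hv : B v v = ∑ i, B (b.repr v i • b i) v := by
    rw [← LinearMap.sum_apply, ← map_sum, b.sum_repr v]
  rw [hv]
  refine Finset.sum_congr rfl fun i _ => ?_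
  have := hw i
  rw [map_smul, LinearMap.smul_apply, smul_eq_mul, key i]
  field_simp

/-- The inversive product as a bilinear form. -/
def inversiveForm (d : ℕ) : LinearMap.BilinForm ℝ (Fin (d + 2) → ℝ) :=
  LinearMap.mk₂ ℝ (Qd d)
    (fun a b c => by simp only [Qd, Pi.add_apply, add_mul, Finset.sum_add_distrib]; ring)
    (fun r a b => by
      simp only [Qd, Pi.smul_apply, smul_eq_mul, mul_assoc, ← Finset.mul_sum]; ring)
    (fun a b c => by simp only [Qd, Pi.add_apply, mul_add, Finset.sum_add_distrib]; ring)
    (fun r a b => by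
      simp only [Qd, Pi.smul_apply, smul_eq_mul, mul_left_comm _ r, ← Finset.mul_sum]; ring)

@[simp]
theorem inversiveForm_apply (d : ℕ) (a b : Fin (d + 2) → ℝ) :
    inversiveForm d a b = Qd d a b := rfl

/-- The isotropic vector representing the curvature functional up to sign. -/
def curvatureVector (d : ℕ) : Fin (d + 2) → ℝ :=
  Fin.snoc (Fin.snoc (fun _ : Fin d => (0 : ℝ)) 1 : Fin (d + 1) → ℝ) 1

theorem Qd_curvatureVector (d : ℕ) (a : Fin (d + 2) → ℝ) :
    Qd d a (curvatureVector d) = -curvd d a := by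
  simp [Qd, curvatureVector, curvd, Fin.sum_univ_castSucc]

theorem curvd_curvatureVector (d : ℕ) : curvd d (curvatureVector d) = 0 := by
  simp [curvatureVector, curvd]

section Geodesic

variable {n m : ℕ} {α : Type*} [DecidableEq α] {u : Fin (n + 1) → Fin m → α}

theorem hammingDist_le_of_path
    (hpath : ∀ i : Fin n, hammingDist (u i.castSucc) (u i.succ) = 1) (i j : Fin (n + 1)) :
    i ≤ j → hammingDist (u i) (u j) + i ≤ j := by
  induction j using Fin.induction with
  | zero =>
    intro h
    obtain rfl : i = 0 := Fin.le_zero_iff.mp h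
    simp
  | succ j ih =>
    intro h
    rcases h.eq_or_lt with rfl | h
    · simp
    · have h1 := ih (Fin.le_castSucc_iff.mpr h)
      have h2 := hammingDist_triangle (u i) (u j.castSucc) (u j.succ)
      rw [hpath j] at h2
      simp only [Fin.val_castSucc, Fin.val_succ] at h1 ⊢
      omega

theorem hammingDist_eq_abs_sub_of_geodesic
    (hpath : ∀ i : Fin n, hammingDist (u i.castSucc) (u i.succ) = 1)
    (hends : hammingDist (u 0) (u (Fin.last n)) = n) (i j : Fin (n + 1)) :
    (hammingDist (u i) (u j) : ℝ) = |(i : ℝ) - j| := by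
  wlog hij : i ≤ j generalizing i j
  · rw [hammingDist_comm, abs_sub_comm]
    exact this j i (le_of_not_ge hij)
  have h0 := hammingDist_le_of_path hpath 0 i (Fin.zero_le i)
  have h1 := hammingDist_le_of_path hpath i j hij
  have h2 := hammingDist_le_of_path hpath j (Fin.last n) (Fin.le_last j)
  have t1 := hammingDist_triangle (u 0) (u i) (u (Fin.last n))
  have t2 := hammingDist_triangle (u i) (u j) (u (Fin.last n))
  simp only [Fin.val_zero, Fin.val_last] at h0 h2
  have h : hammingDist (u i) (u j) + i = (j : ℕ) := by omega
  have h' : (hammingDist (u i) (u j) : ℝ) + i = j := by exact_mod_cast h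
  rw [abs_sub_comm, abs_of_nonneg] <;> linarith [(hammingDist (u i) (u j)).cast_nonneg (α := ℝ)]

end Geodesic

/-- The sum of the extreme vectors, followed by the consecutive differences. -/
def differenceFrame {d : ℕ} (y : Fin (d + 2) → Fin (d + 2) → ℝ) :
    Fin (d + 2) → Fin (d + 2) → ℝ :=
  Fin.cons (y 0 + y (Fin.last (d + 1))) fun i : Fin (d + 1) => y i.castSucc - y i.succ

section Frame

variable {d : ℕ} {y : Fin (d + 2) → Fin (d + 2) → ℝ}

theorem inversiveForm_differenceFrame_zero
    (hy : ∀ i j, inversiveForm d (y i) (y j) = 1 - 2 * |(i : ℝ) - j|) :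
    inversiveForm d (differenceFrame y 0) (differenceFrame y 0) = -4 * d := by
  have h : |(0 : ℝ) - (d + 1)| = d + 1 := by
    rw [zero_sub, abs_neg, abs_of_nonneg (by positivity)]
  have h' : |(d + 1 : ℝ) - 0| = d + 1 := by
    rw [sub_zero, abs_of_nonneg (by positivity)]
  simp only [differenceFrame, Fin.cons_zero, map_add, LinearMap.add_apply, hy, Fin.val_zero,
    Fin.val_last, Nat.cast_zero, Nat.cast_add, Nat.cast_one, h, h', sub_self, abs_zero]
  ring

theorem inversiveForm_differenceFrame_succ
    (hy : ∀ i j, inversiveForm d (y i) (y j) = 1 - 2 * |(i : ℝ) - j|) (i : Fin (d + 1)) :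
    inversiveForm d (differenceFrame y i.succ) (differenceFrame y i.succ) = 4 := by
  simp only [differenceFrame, Fin.cons_succ, map_sub, LinearMap.sub_apply, hy, Fin.val_succ,
    Fin.val_castSucc, Nat.cast_add, Nat.cast_one, sub_self, abs_zero, sub_add_cancel_left,
    add_sub_cancel_left, abs_neg, abs_one]
  norm_num

theorem isOrtho_differenceFrame
    (hy : ∀ i j, inversiveForm d (y i) (y j) = 1 - 2 * |(i : ℝ) - j|) :
    (inversiveForm d).IsOrthoᵢ (differenceFrame y) := by
  have symm (i j) (h : inversiveForm d (differenceFrame y i) (differenceFrame y j) = 0) :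
      inversiveForm d (differenceFrame y j) (differenceFrame y i) = 0 := by
    rw [← h]
    simp only [inversiveForm_apply, Qd, mul_comm]
  rw [LinearMap.isOrthoᵢ_def]
  intro i j hij
  wlog hlt : i < j generalizing i j
  · exact symm _ _ (this j i hij.symm (lt_of_le_of_ne (not_lt.mp hlt) hij.symm))
  obtain ⟨j, rfl⟩ := Fin.exists_succ_eq.mpr (Fin.ne_zero_of_lt hlt)
  have hjd : (j : ℝ) ≤ d := by exact_mod_cast Nat.lt_succ_iff.mp j.isLt
  have hj0 : (0 : ℝ) ≤ j := by positivity
  cases i using Fin.cases with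
  | zero =>
    simp only [differenceFrame, Fin.cons_zero, Fin.cons_succ, map_add, map_sub,
      LinearMap.add_apply, hy, Fin.val_zero, Fin.val_last, Fin.val_succ, Fin.val_castSucc,
      Nat.cast_zero, Nat.cast_add, Nat.cast_one]
    rw [abs_of_nonpos (by linarith), abs_of_nonneg (by linarith), abs_of_nonpos (by linarith),
      abs_of_nonneg (by linarith)]
    ring
  | succ i =>
    have h : (i : ℝ) + 1 ≤ j := by exact_mod_cast Fin.succ_lt_succ_iff.mp hlt
    simp only [differenceFrame, Fin.cons_succ, map_sub, LinearMap.sub_apply, hy, Fin.val_succ,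
      Fin.val_castSucc, Nat.cast_add, Nat.cast_one]
    rw [abs_of_nonpos (by linarith), abs_of_nonpos (by linarith), abs_of_nonpos (by linarith),
      abs_of_nonpos (by linarith)]
    ring

end Frame

/-- Hypercubical Descartes theorem: for d+2 consecutively tangent balls of a (d+1)-cube
packing whose first and last vertices are antipodal, the curvatures satisfy
`d·∑ (κᵢ − κᵢ₊₁)² = (κ₁ + κ_{d+2})²`. -/
theorem hypercubical_descartes (d : ℕ) (hd : 1 ≤ d)
    (x : (Fin (d + 1) → Bool) → (Fin (d + 2) → ℝ)) (hx : IsCubePacking d x)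
    (u : Fin (d + 2) → (Fin (d + 1) → Bool))
    (hpath : ∀ i : Fin (d + 1), hammingDist (u i.castSucc) (u i.succ) = 1)
    (hends : hammingDist (u 0) (u (Fin.last (d + 1))) = d + 1) :
    (d : ℝ) * ∑ i : Fin (d + 1),
        (curvd d (x (u i.castSucc)) - curvd d (x (u i.succ))) ^ 2 =
      (curvd d (x (u 0)) + curvd d (x (u (Fin.last (d + 1))))) ^ 2 := by
  have hy (i j : Fin (d + 2)) :
      inversiveForm d (x (u i)) (x (u j)) = 1 - 2 * |(i : ℝ) - j| := by
    rw [inversiveForm_apply, hx, hammingDist_eq_abs_sub_of_geodesic hpath hends]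
  set f := differenceFrame fun i => x (u i) with hf
  have h_zero : inversiveForm d (f 0) (f 0) = -4 * d := inversiveForm_differenceFrame_zero hy
  have h_succ (i : Fin (d + 1)) : inversiveForm d (f i.succ) (f i.succ) = 4 :=
    inversiveForm_differenceFrame_succ hy i
  have h_ortho : (inversiveForm d).IsOrthoᵢ f := isOrtho_differenceFrame hy
  have hd0 : (d : ℝ) ≠ 0 := by positivity
  have h_ne (i) : inversiveForm d (f i) (f i) ≠ 0 := by
    cases i using Fin.cases with
    | zero => rw [h_zero]; exact mul_ne_zero (by norm_num) hd0
    | succ i => rw [h_succ]; norm_num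
  have h_indep : LinearIndependent ℝ f :=
    LinearMap.linearIndependent_of_isOrthoᵢ h_ortho fun i => h_ne i
  let b := basisOfLinearIndependentOfCardEqFinrank h_indep (by simp)
  have hb : ⇑b = f := coe_basisOfLinearIndependentOfCardEqFinrank _ _
  have h := b.bilinForm_self_eq_sum_sq_div (inversiveForm d) (hb ▸ h_ortho) (by rwa [hb])
    (curvatureVector d)
  have h_sum : f 0 = x (u 0) + x (u (Fin.last (d + 1))) := rfl
  have h_diff (i : Fin (d + 1)) : f i.succ = x (u i.castSucc) - x (u i.succ) := rfl
  rw [hb, Fin.sum_univ_succ, h_zero] at h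
  simp only [h_succ] at h
  simp only [h_sum, h_diff, map_add, map_sub, LinearMap.add_apply, LinearMap.sub_apply,
    inversiveForm_apply, Qd_curvatureVector, curvd_curvatureVector, ← Finset.sum_div] at h
  field_simp at h
  have h_sq (i : Fin (d + 1)) :
      (-curvd d (x (u i.castSucc)) - -curvd d (x (u i.succ))) ^ 2 =
        (curvd d (x (u i.castSucc)) - curvd d (x (u i.succ))) ^ 2 := by ring
  simp only [h_sq] at h
  linarith
end
end

section
/- Integrality criterion for octahedral Apollonian disk packings. Let y be an octahedral disk packing and set a := κ(y₁), b := κ(y₂), c := κ(y₃) (the curvatures of three pairwise tangent disks of the packing). Then the octahedral Apollonian packing Ω(y) is integral if and only if a, b, c are integers and there exists an integer n with n² = 2(ab + bc + ca). -/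
noncomputable section

/-- An octahedral disk packing, indexed by `{±1,±2,±3}` (here `Fin 3 × Bool`,
with negation flipping the boolean; `true` stands for the positive indices). -/
def IsOctaPacking (y : Fin 3 × Bool → (Fin 4 → ℝ)) : Prop :=
  (∀ k, Q2 (y k) (y k) = 1) ∧
  (∀ k l, l ≠ k → l ≠ (k.1, !k.2) → Q2 (y k) (y l) = -1) ∧
  (∀ k, Q2 (y k) (y (k.1, !k.2)) = -3)

/-- Generators of the octahedral Apollonian group. -/
def octaGens (y : Fin 3 × Bool → (Fin 4 → ℝ)) : Set ((Fin 4 → ℝ) ≃ₗ[ℝ] (Fin 4 → ℝ)) :=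
  {g | ∃ w : Fin 4 → ℝ, Q2 w w = 1 ∧ (∃ ε : Fin 3 → Bool, ∀ i, Q2 w (y (i, ε i)) = 0) ∧
        ∀ z, g z = z - (2 * Q2 z w) • w}

/-- The octahedral Apollonian packing. -/
def octaOmega (y : Fin 3 × Bool → (Fin 4 → ℝ)) : Set (Fin 4 → ℝ) :=
  {b | ∃ g ∈ Subgroup.closure (octaGens y), ∃ k, b = g (y k)}

theorem Q2_add_left (a b c : Fin 4 → ℝ) : Q2 (a + b) c = Q2 a c + Q2 b c := by
  simp only [Q2, Pi.add_apply]; ring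

theorem Q2_smul_left (r : ℝ) (a c : Fin 4 → ℝ) : Q2 (r • a) c = r * Q2 a c := by
  simp only [Q2, Pi.smul_apply, smul_eq_mul]; ring

theorem Q2_add_right (a b c : Fin 4 → ℝ) : Q2 a (b + c) = Q2 a b + Q2 a c := by
  simp only [Q2, Pi.add_apply]; ring

theorem Q2_smul_right (r : ℝ) (a c : Fin 4 → ℝ) : Q2 a (r • c) = r * Q2 a c := by
  simp only [Q2, Pi.smul_apply, smul_eq_mul]; ring

theorem curv2_add (a b : Fin 4 → ℝ) : curv2 (a + b) = curv2 a + curv2 b := by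
  simp only [curv2, Pi.add_apply]; ring

theorem curv2_sub (a b : Fin 4 → ℝ) : curv2 (a - b) = curv2 a - curv2 b := by
  simp only [curv2, Pi.sub_apply]; ring

theorem curv2_smul (r : ℝ) (a : Fin 4 → ℝ) : curv2 (r • a) = r * curv2 a := by
  simp only [curv2, Pi.smul_apply, smul_eq_mul]; ring

/-- A vector orthogonal to four pairwise orthogonal non-isotropic vectors of `ℝ⁴` vanishes. -/
theorem eq_zero_of_orthogonal_frame {v : Fin 4 → Fin 4 → ℝ} {d : Fin 4 → ℝ}
    (hd : ∀ i, d i ≠ 0) (h : ∀ i j, Q2 (v i) (v j) = if i = j then d i else 0)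
    {z : Fin 4 → ℝ} (hz : ∀ i, Q2 z (v i) = 0) : z = 0 := by
  let J : Fin 4 → ℝ := ![1, 1, 1, -1]
  have hG : Matrix.of v * Matrix.diagonal J * (Matrix.of v).transpose = Matrix.diagonal d := by
    ext i j
    rw [Matrix.diagonal_apply, ← h i j, Matrix.mul_apply]
    simp [Matrix.mul_diagonal, Fin.sum_univ_four, J, Q2]
    ring
  have hdet : (Matrix.of v).det ≠ 0 := by
    intro h0
    have := congrArg Matrix.det hG
    rw [Matrix.det_mul, Matrix.det_mul, h0, Matrix.det_diagonal, Matrix.det_diagonal] at this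
    simp only [zero_mul] at this
    exact Finset.prod_ne_zero_iff.mpr (fun i _ => hd i) this.symm
  have hJz : (fun i => J i * z i) = 0 := by
    apply Matrix.eq_zero_of_mulVec_eq_zero hdet
    ext i
    have := hz i
    simp only [Q2] at this
    simp [Matrix.mulVec, dotProduct, Fin.sum_univ_four, J]
    linarith
  ext i
  have := congrFun hJz i
  fin_cases i <;> simpa [J] using this

/-- An orthogonal frame of one timelike vector of norm `-1` and three spacelike vectors of
norm `2`. -/
structure IsOctaFrame (u : Fin 4 → ℝ) (e : Fin 3 → Fin 4 → ℝ) : Prop where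
  center : Q2 u u = -1
  center_axis : ∀ i, Q2 u (e i) = 0
  axis : ∀ i j, Q2 (e i) (e j) = if i = j then 2 else 0

namespace IsOctaFrame

variable {u : Fin 4 → ℝ} {e : Fin 3 → Fin 4 → ℝ}

theorem eq_zero (h : IsOctaFrame u e) {z : Fin 4 → ℝ} (hu : Q2 z u = 0)
    (he : ∀ i, Q2 z (e i) = 0) : z = 0 := by
  apply eq_zero_of_orthogonal_frame (v := Fin.cons u e) (d := Fin.cons (-1) fun _ => 2)
  · intro i
    refine Fin.cases ?_ (fun i => ?_) i <;> simp
  · intro i j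
    refine Fin.cases ?_ (fun i => ?_) i <;> refine Fin.cases ?_ (fun j => ?_) j
    · simp [h.center]
    · simp [h.center_axis, (Fin.succ_ne_zero _).symm]
    · simp [Q2_comm (e i), h.center_axis]
    · simp [h.axis]
  · intro i
    refine Fin.cases ?_ (fun i => ?_) i
    · simpa using hu
    · simpa using he i

theorem expansion (h : IsOctaFrame u e) (z : Fin 4 → ℝ) :
    z = (-Q2 z u) • u + (Q2 z (e 0) / 2) • e 0 + (Q2 z (e 1) / 2) • e 1
      + (Q2 z (e 2) / 2) • e 2 := by
  rw [← sub_eq_zero]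
  apply h.eq_zero
  · simp only [Q2_sub_left, Q2_add_left, Q2_smul_left, Q2_comm (e _) u, h.center, h.center_axis]
    ring
  · intro i
    fin_cases i <;>
      simp [Q2_sub_left, Q2_add_left, Q2_smul_left, h.axis, h.center_axis, -neg_smul]

theorem curv2_relation (h : IsOctaFrame u e) :
    curv2 (e 0) ^ 2 + curv2 (e 1) ^ 2 + curv2 (e 2) ^ 2 = 2 * curv2 u ^ 2 := by
  have hN : ∀ z, Q2 ![0, 0, 1, 1] z = -curv2 z := fun z => by simp [Q2, curv2]
  have hz : curv2 ![0, 0, 1, 1] = 0 := by simp [curv2]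
  have := congrArg curv2 (h.expansion ![0, 0, 1, 1])
  simp only [hN, hz, curv2_add, curv2_smul] at this
  linarith

/-- The integer lattice of a frame. -/
def lattice (u : Fin 4 → ℝ) (e : Fin 3 → Fin 4 → ℝ) : AddSubgroup (Fin 4 → ℝ) :=
  AddSubgroup.closure (insert u (Set.range e))

theorem center_mem : u ∈ lattice u e := AddSubgroup.subset_closure (Set.mem_insert _ _)

theorem axis_mem (i : Fin 3) : e i ∈ lattice u e :=
  AddSubgroup.subset_closure (Set.mem_insert_of_mem _ (Set.mem_range_self i))

theorem lattice_induction {f : (Fin 4 → ℝ) → ℝ} (hadd : ∀ a b, f (a + b) = f a + f b)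
    (hu : ∃ n : ℤ, f u = n) (he : ∀ i, ∃ n : ℤ, f (e i) = n) {z : Fin 4 → ℝ}
    (hz : z ∈ lattice u e) : ∃ n : ℤ, f z = n := by
  let F : (Fin 4 → ℝ) →+ ℝ := AddMonoidHom.mk' f hadd
  have hle : lattice u e ≤ (Int.castAddHom ℝ).range.comap F := by
    rw [lattice, AddSubgroup.closure_le]
    rintro x (rfl | ⟨i, rfl⟩)
    · obtain ⟨n, hn⟩ := hu
      exact ⟨n, hn.symm⟩
    · obtain ⟨n, hn⟩ := he i
      exact ⟨n, hn.symm⟩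
  obtain ⟨n, hn⟩ := hle hz
  exact ⟨n, hn.symm⟩

theorem Q2_int (h : IsOctaFrame u e) {z w : Fin 4 → ℝ} (hz : z ∈ lattice u e)
    (hw : w ∈ lattice u e) : ∃ n : ℤ, Q2 z w = n := by
  refine lattice_induction (f := fun z => Q2 z w) (fun _ _ => Q2_add_left _ _ _) ?_ ?_ hz
  · refine lattice_induction (Q2_add_right u) ⟨-1, by simp [h.center]⟩
      (fun i => ⟨0, by simp [h.center_axis]⟩) hw
  · intro j
    refine lattice_induction (Q2_add_right (e j)) ⟨0, by simp [Q2_comm (e j), h.center_axis]⟩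
      (fun i => ⟨if j = i then 2 else 0, by simp [h.axis]⟩) hw

/-- Reflections in unit vectors orthogonal to three vectors `u ± eᵢ` preserve the lattice. -/
theorem reflection_mem (h : IsOctaFrame u e) {w : Fin 4 → ℝ} (hw : Q2 w w = 1)
    {ε : Fin 3 → ℤ} (hε : ∀ i, ε i = 1 ∨ ε i = -1)
    (hortho : ∀ i, Q2 w (u + (ε i : ℝ) • e i) = 0) {z : Fin 4 → ℝ} (hz : z ∈ lattice u e) :
    z - (2 * Q2 z w) • w ∈ lattice u e := by
  have hsq : ∀ i, (ε i : ℝ) ^ 2 = 1 := fun i => by rcases hε i with h | h <;> simp [h]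
  have hβ : ∀ i, Q2 w (e i) = ε i * (-Q2 w u) := fun i => by
    have := hortho i
    rw [Q2_add_right, Q2_smul_right] at this
    linear_combination (ε i : ℝ) * this - Q2 w (e i) * hsq i
  let t : Fin 4 → ℝ := (2 : ℤ) • u + ε 0 • e 0 + ε 1 • e 1 + ε 2 • e 2
  have ht : t ∈ lattice u e :=
    add_mem (add_mem (add_mem (zsmul_mem center_mem _) (zsmul_mem (axis_mem _) _))
      (zsmul_mem (axis_mem _) _)) (zsmul_mem (axis_mem _) _)
  have hwt : w = (-Q2 w u / 2) • t := by
    conv_lhs => rw [h.expansion w, hβ, hβ, hβ]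
    ext k
    simp only [t, Pi.add_apply, Pi.smul_apply, smul_eq_mul]
    simp only [zsmul_eq_mul]
    push_cast
    ring
  have hα : Q2 w u ^ 2 = 2 := by
    have := congrArg (Q2 w) (h.expansion w)
    simp only [Q2_add_right, Q2_smul_right, hw, hβ] at this
    linear_combination (-2) * this - Q2 w u ^ 2 * (hsq 0 + hsq 1 + hsq 2)
  obtain ⟨n, hn⟩ := h.Q2_int hz ht
  have key : (2 * Q2 z w) • w = n • t := by
    have : Q2 z w = -Q2 w u / 2 * n := by
      rw [← hn, ← Q2_smul_right, ← hwt]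
    rw [this]
    generalize Q2 w u = α at hwt hα ⊢
    rw [hwt, smul_smul, ← Int.cast_smul_eq_zsmul ℝ]
    congr 1
    linear_combination (n / 2 : ℝ) * hα
  rw [key]
  exact sub_mem hz (zsmul_mem ht _)

end IsOctaFrame

theorem reflection_reflection {w : Fin 4 → ℝ} (hw : Q2 w w = 1) (z : Fin 4 → ℝ) :
    (z - (2 * Q2 z w) • w) - (2 * Q2 (z - (2 * Q2 z w) • w) w) • w = z := by
  rw [Q2_sub_left, Q2_smul_left, hw]
  ext k
  simp only [Pi.sub_apply, Pi.smul_apply, smul_eq_mul]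
  ring

/-- An octahedral packing is given by the vectors `u ± eᵢ` for a frame `u, e`. -/
theorem IsOctaPacking.exists_frame {y : Fin 3 × Bool → (Fin 4 → ℝ)} (hy : IsOctaPacking y) :
    ∃ u e, IsOctaFrame u e ∧ ∀ i, y (i, true) = u + e i ∧ y (i, false) = u - e i := by
  obtain ⟨h1, h2, h3⟩ := hy
  have hQ : ∀ i j s, Q2 (y (i, s)) (y (j, true)) =
      if i = j then (if s then 1 else -3) else -1 := by
    intro i j s
    split_ifs with hij hs
    · subst hij hs
      exact h1 _
    · subst hij
      rw [Bool.not_eq_true] at hs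
      subst hs
      exact h3 (i, false)
    · exact h2 _ _ (by simp [Ne.symm hij]) (by simp [Ne.symm hij])
  have hF : ∀ i j, Q2 (y (i, false)) (y (j, false)) = if i = j then 1 else -1 := by
    intro i j
    split_ifs with hij
    · subst hij
      exact h1 _
    · exact h2 _ _ (by simp [Ne.symm hij]) (by simp [Ne.symm hij])
  set u : Fin 4 → ℝ := (1 / 2 : ℝ) • (y (0, true) + y (0, false)) with hu
  set e : Fin 3 → Fin 4 → ℝ := fun i => y (i, true) - u with he
  have huy : ∀ i, Q2 u (y (i, true)) = -1 := by
    intro i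
    rw [hu, Q2_smul_left, Q2_add_left, hQ, hQ]
    simp only [if_true, Bool.false_eq_true, if_false]
    split_ifs <;> norm_num
  have hyu : ∀ i, Q2 (y (i, false)) u = -1 := by
    intro i
    rw [hu, Q2_smul_right, Q2_add_right, hQ, hF]
    simp only [Bool.false_eq_true, if_false]
    split_ifs <;> norm_num
  have huu : Q2 u u = -1 := by
    conv_lhs => rw [hu]
    rw [Q2_smul_left, Q2_add_left, hyu, Q2_comm, huy]
    norm_num
  have hfr : IsOctaFrame u e := by
    refine ⟨huu, fun i => ?_, fun i j => ?_⟩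
    · rw [he, Q2_sub_right, huy, huu]
      norm_num
    · simp only [he, Q2_sub_left, Q2_sub_right, huy, huu, Q2_comm (y _) u, hQ, if_true]
      split_ifs <;> norm_num
  refine ⟨u, e, hfr, fun i => ⟨by simp [he], ?_⟩⟩
  rw [← sub_eq_zero]
  apply hfr.eq_zero
  · rw [Q2_sub_left, Q2_sub_left, hyu, huu, Q2_comm, hfr.center_axis]
    norm_num
  · intro j
    rw [Q2_sub_left, Q2_sub_left, hfr.center_axis, hfr.axis]
    simp only [he, Q2_sub_right, hyu, hQ]
    simp only [Bool.false_eq_true, if_false]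
    split_ifs <;> norm_num

/-- The octahedral Apollonian group preserves the lattice of the frame of the packing. -/
theorem IsOctaFrame.apply_mem_iff {u : Fin 4 → ℝ} {e : Fin 3 → Fin 4 → ℝ} (h : IsOctaFrame u e)
    {y : Fin 3 × Bool → (Fin 4 → ℝ)}
    (hye : ∀ i, y (i, true) = u + e i ∧ y (i, false) = u - e i)
    {g : (Fin 4 → ℝ) ≃ₗ[ℝ] (Fin 4 → ℝ)} (hg : g ∈ Subgroup.closure (octaGens y)) :
    ∀ z, g z ∈ lattice u e ↔ z ∈ lattice u e := by
  induction hg using Subgroup.closure_induction with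
  | mem g hg =>
    obtain ⟨w, hw, ⟨ε, hε⟩, hgz⟩ := hg
    have hmem : ∀ z ∈ lattice u e, g z ∈ lattice u e := by
      intro z hz
      rw [hgz]
      refine h.reflection_mem hw (ε := fun i => if ε i then 1 else -1)
        (fun i => by cases ε i <;> simp) (fun i => ?_) hz
      rw [← hε i]
      cases hi : ε i
      · simp [(hye i).2, sub_eq_add_neg]
      · simp [(hye i).1]
    refine fun z => ⟨fun hz => ?_, hmem z⟩
    have := hmem _ hz
    rwa [hgz (g z), hgz z, reflection_reflection hw] at this
  | one => exact fun z => Iff.rfl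
  | mul g k _ _ hg hk => exact fun z => (hg (k z)).trans (hk z)
  | inv g _ hg =>
    intro z
    rw [← hg (g⁻¹ z)]
    exact iff_of_eq (congrArg (· ∈ lattice u e) (g.apply_symm_apply z))

/-- Integrality criterion for octahedral Apollonian disk packings: the packing is integral iff
the curvatures a, b, c of three pairwise tangent disks are integers and `2(ab+bc+ca)` is a
perfect square. -/
theorem octahedral_integrality (y : Fin 3 × Bool → (Fin 4 → ℝ)) (hy : IsOctaPacking y)
    (a b c : ℝ) (ha : a = curv2 (y (0, true))) (hb : b = curv2 (y (1, true)))
    (hc : c = curv2 (y (2, true))) :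
    (∀ z ∈ octaOmega y, ∃ n : ℤ, curv2 z = n) ↔
      ((∃ m : ℤ, a = m) ∧ (∃ m : ℤ, b = m) ∧ (∃ m : ℤ, c = m) ∧
        ∃ n : ℤ, (n : ℝ) ^ 2 = 2 * (a * b + b * c + c * a)) := by
  obtain ⟨u, e, h, hye⟩ := hy.exists_frame
  have hrel := h.curv2_relation
  have hyc : ∀ i, curv2 (y (i, true)) = curv2 u + curv2 (e i) := fun i => by
    rw [(hye i).1, curv2_add]
  rw [hyc] at ha hb hc
  have hsq : (curv2 u - (a + b + c)) ^ 2 = 2 * (a * b + b * c + c * a) := by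
    rw [ha, hb, hc]
    linear_combination hrel
  constructor
  · intro hint
    have hy_int : ∀ k, ∃ n : ℤ, curv2 (y k) = n := fun k =>
      hint _ ⟨1, one_mem _, k, rfl⟩
    obtain ⟨A, hA⟩ := hy_int (0, true)
    obtain ⟨B, hB⟩ := hy_int (1, true)
    obtain ⟨C, hC⟩ := hy_int (2, true)
    obtain ⟨A', hA'⟩ := hy_int (0, false)
    rw [hyc, ← ha] at hA
    rw [hyc, ← hb] at hB
    rw [hyc, ← hc] at hC
    rw [(hye 0).2, curv2_sub] at hA'
    refine ⟨⟨A, hA⟩, ⟨B, hB⟩, ⟨C, hC⟩, ?_⟩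
    have hm : ((A + A' - 2 * (A + B + C) : ℤ) : ℝ) = 2 * (curv2 u - (a + b + c)) := by
      push_cast
      rw [← hA, ← hB, ← hC, ← hA', ha]
      ring
    have hm2 : (A + A' - 2 * (A + B + C)) ^ 2 = 2 * (4 * (A * B + B * C + C * A)) := by
      have : (((A + A' - 2 * (A + B + C) : ℤ) : ℝ)) ^ 2 =
          2 * (4 * (A * B + B * C + C * A)) := by
        rw [hm, ← hA, ← hB, ← hC]
        linear_combination 4 * hsq
      exact_mod_cast this
    obtain ⟨n, hn⟩ := Int.prime_two.dvd_of_dvd_pow ⟨_, hm2⟩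
    refine ⟨n, ?_⟩
    rw [hn] at hm
    push_cast at hm
    rw [← hsq, mul_left_cancel₀ two_ne_zero hm]
  · rintro ⟨⟨A, hA⟩, ⟨B, hB⟩, ⟨C, hC⟩, n, hn⟩
    have hd : ∃ D : ℤ, curv2 u = D := by
      rcases sq_eq_sq_iff_eq_or_eq_neg.mp (hsq.trans hn.symm) with h' | h'
      · exact ⟨A + B + C + n, by push_cast; linarith⟩
      · exact ⟨A + B + C - n, by push_cast; linarith⟩
    obtain ⟨D, hD⟩ := hd
    rintro _ ⟨g, hg, ⟨i, s⟩, rfl⟩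
    have hmem : y (i, s) ∈ IsOctaFrame.lattice u e := by
      cases s
      · rw [(hye i).2]
        exact sub_mem IsOctaFrame.center_mem (IsOctaFrame.axis_mem i)
      · rw [(hye i).1]
        exact add_mem IsOctaFrame.center_mem (IsOctaFrame.axis_mem i)
    refine IsOctaFrame.lattice_induction curv2_add ⟨D, hD⟩ ?_ ((h.apply_mem_iff hye hg _).mpr hmem)
    rw [Fin.forall_fin_succ, Fin.forall_fin_two]
    exact ⟨⟨A - D, by push_cast; linarith⟩, ⟨B - D, by push_cast; linarith⟩,
      ⟨C - D, by push_cast; linarith⟩⟩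
end
end

section
/- Simplicial quadratic form identity. Let d ≥ 1 be an integer and u₁,…,u_{d+2} ∈ ℝ. For i = 0,…,d+1 set xᵢ := (u₁ + ⋯ + u_{i+1})/(i+1). Then −Σ_{i=0}^{d} ((i+1)(i+2)/2)·(xᵢ − xᵢ₊₁)² + ((d+2)/d)·x_{d+1}² = (1/2)·((1/d)·(u₁ + ⋯ + u_{d+2})² − (u₁² + ⋯ + u_{d+2}²)). -/
noncomputable section

open Finset

theorem sum_filter_le_fin_eq_sum_range {n : ℕ} (v : ℕ → ℝ) (i : Fin n) :
    ∑ j ∈ Finset.univ.filter (fun j : Fin n => j ≤ i), v j = ∑ k ∈ range (i + 1), v k := by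
  rw [sum_filter]
  simp only [Fin.le_def]
  rw [Fin.sum_univ_eq_sum_range (fun k => if k ≤ (i : ℕ) then v k else 0) n, ← sum_filter]
  congr 1
  ext k
  have := i.isLt
  simp only [mem_filter, mem_range]
  omega

/-- Helmert's decomposition of the sum of squares into successive differences of averages. -/
theorem sum_sq_sub_average_succ (v : ℕ → ℝ) (n : ℕ) :
    ∑ i ∈ range n, (((i : ℝ) + 1) * ((i : ℝ) + 2) / 2) *
        ((∑ k ∈ range (i + 1), v k) / ((i : ℝ) + 1) -
          (∑ k ∈ range (i + 2), v k) / ((i : ℝ) + 2)) ^ 2 =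
      (1 / 2) * (∑ k ∈ range (n + 1), v k ^ 2 -
        (∑ k ∈ range (n + 1), v k) ^ 2 / ((n : ℝ) + 1)) := by
  induction n with
  | zero => simp
  | succ n ih =>
    rw [sum_range_succ, ih, sum_range_succ _ (n + 1), sum_range_succ _ (n + 1)]
    have h1 : (n : ℝ) + 1 ≠ 0 := by positivity
    have h2 : (n : ℝ) + 2 ≠ 0 := by positivity
    have h3 : ((n + 1 : ℕ) : ℝ) + 1 = (n : ℝ) + 2 := by push_cast; ring
    rw [h3]
    field_simp
    ring

/-- Simplicial quadratic form identity: the flag quadratic form of the regular (d+1)-simplex,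
evaluated at the partial averages of u₁,…,u_{d+2}, equals the simplicial quadratic form
𝔗_{d+1}(u₁,…,u_{d+2}). -/
theorem simplicial_quadratic_form_identity (d : ℕ) (hd : 1 ≤ d)
    (u x : Fin (d + 2) → ℝ)
    (hx : ∀ i : Fin (d + 2),
      x i = (∑ j ∈ Finset.univ.filter fun j : Fin (d + 2) => j ≤ i, u j) / ((i : ℕ) + 1)) :
    -(∑ i : Fin (d + 1),
        ((((i : ℕ) + 1) * ((i : ℕ) + 2) / 2 : ℝ)) * (x i.castSucc - x i.succ) ^ 2) +
      ((d + 2 : ℝ) / d) * (x (Fin.last (d + 1))) ^ 2 =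
    (1 / 2 : ℝ) * ((1 / d) * (∑ j : Fin (d + 2), u j) ^ 2 - ∑ j : Fin (d + 2), (u j) ^ 2) := by
  obtain ⟨v, rfl⟩ : ∃ v : ℕ → ℝ, u = fun j : Fin (d + 2) => v j :=
    ⟨fun k => if h : k < d + 2 then u ⟨k, h⟩ else 0, by ext j; simp⟩
  simp only [sum_filter_le_fin_eq_sum_range] at hx
  have hsum : ∑ i : Fin (d + 1), ((((i : ℕ) + 1) * ((i : ℕ) + 2) / 2 : ℝ)) *
      (x i.castSucc - x i.succ) ^ 2 =
      (1 / 2) * (∑ k ∈ range (d + 2), v k ^ 2 -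
        (∑ k ∈ range (d + 2), v k) ^ 2 / ((d : ℝ) + 2)) := by
    have h := sum_sq_sub_average_succ v (d + 1)
    rw [← Fin.sum_univ_eq_sum_range (fun i : ℕ => (((i : ℝ) + 1) * ((i : ℝ) + 2) / 2) *
        ((∑ k ∈ range (i + 1), v k) / ((i : ℝ) + 1) -
          (∑ k ∈ range (i + 2), v k) / ((i : ℝ) + 2)) ^ 2)] at h
    have h3 : ((d + 1 : ℕ) : ℝ) + 1 = (d : ℝ) + 2 := by push_cast; ring
    rw [h3] at h
    rw [← h]
    refine sum_congr rfl fun i _ => ?_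
    have h4 : (((i : ℕ) + 1 : ℕ) : ℝ) + 1 = ((i : ℕ) : ℝ) + 2 := by push_cast; ring
    rw [hx, hx, Fin.val_castSucc, Fin.val_succ, h4]
  have hlast : x (Fin.last (d + 1)) = (∑ k ∈ range (d + 2), v k) / ((d : ℝ) + 2) := by
    rw [hx, Fin.val_last]
    push_cast
    ring
  rw [hsum, hlast, Fin.sum_univ_eq_sum_range v, Fin.sum_univ_eq_sum_range (fun k => v k ^ 2)]
  have hd0 : (d : ℝ) ≠ 0 := by positivity
  have hd2 : (d : ℝ) + 2 ≠ 0 := by positivity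
  field_simp
  ring
end
end
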